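/- Let O be a maximal order of B_p with successive minima D₁, D₂, D₃ of O^T realized by x, y, z. Then 4p² ≤ D₁·D₂·D₃ < 8p², and {x, y, z} is a ℤ-basis of O^T, i.e. O^T = ℤx + ℤy + ℤz. -/

import Mathlib

open scoped Quaternion

/-- The rational quaternion algebra with `i² = -p`, `j² = -q`. -/
abbrev Bq (p q : ℕ) := ℍ[ℚ, -(p : ℚ), -(q : ℚ)]

namespace GrossPaper

variable {p q : ℕ}

/-- The (reduced) trace `Tr(x) = x + x̄` of a quaternion, as a rational number. -/
def Trq (x : Bq p q) : ℚ := 2 * x.re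

/-- The (reduced) norm `Nr(x) = x·x̄` of a quaternion, as a rational number. -/
def Nrq (x : Bq p q) : ℚ := (x * star x).re

/-- The inverse of a nonzero quaternion: `c⁻¹ = star c / Nr c`. -/
noncomputable def qinv (c : Bq p q) : Bq p q := (Nrq c)⁻¹ • star c

/-- Conjugation of a set: `c S c⁻¹`. -/
noncomputable def conjSet (c : Bq p q) (S : Set (Bq p q)) : Set (Bq p q) :=
  (fun s => c * s * qinv c) '' S

/-- An order of `B_p`: a subring (hence containing `ℤ`) which is a free `ℤ`-module of
rank 4 spanning `B_p` over `ℚ`. -/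
def IsOrder (O : Subring (Bq p q)) : Prop :=
  Nonempty (Module.Basis (Fin 4) ℤ O) ∧ Submodule.span ℚ (O : Set (Bq p q)) = ⊤

/-- A maximal order: an order not properly contained in any other order. -/
def IsMaximalOrder (O : Subring (Bq p q)) : Prop :=
  IsOrder O ∧ ∀ O' : Subring (Bq p q), IsOrder O' → O ≤ O' → O' = O

/-- Two orders are of the same type if they are conjugate. -/
noncomputable def SameType (O O' : Subring (Bq p q)) : Prop :=
  ∃ c : Bq p q, c ≠ 0 ∧ conjSet c (O : Set (Bq p q)) = (O' : Set (Bq p q))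

/-- The Gross lattice `O^T = {2x - Tr(x) : x ∈ O}`. -/
def GrossLat (O : Subring (Bq p q)) : Set (Bq p q) :=
  {t | ∃ x ∈ O, t = 2 * x - algebraMap ℚ (Bq p q) (Trq x)}

/-- `SuccMin T i D` says `D` is the `i`-th successive minimum of `T`: the least real
number such that `T` contains `i` `ℚ`-linearly independent elements of norm at most `D`. -/
def SuccMin (T : Set (Bq p q)) (i : ℕ) (D : ℝ) : Prop :=
  IsLeast {r : ℝ | ∃ v : Fin i → Bq p q, (∀ n, v n ∈ T) ∧ LinearIndependent ℚ v ∧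
    ∀ n, ((Nrq (v n) : ℝ) ≤ r)} D

/-- A primitive element of the Gross lattice. -/
def Primitive (T : Set (Bq p q)) (t : Bq p q) : Prop :=
  t ∈ T ∧ t ≠ 0 ∧ ∀ (a : ℤ) (s : Bq p q), s ∈ T → t = a • s → a = 1 ∨ a = -1

/-- `k` is represented optimally by `T` : `Nr(t) = k` for some primitive `t ∈ T`. -/
def OptRep (T : Set (Bq p q)) (k : ℝ) : Prop :=
  ∃ t : Bq p q, Primitive T t ∧ (Nrq t : ℝ) = k

/-- The multiplicity `θ_T(k)`: half the number of `t ∈ T` with `Nr t = k`. -/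
noncomputable def theta (T : Set (Bq p q)) (k : ℝ) : ℚ :=
  ({t : Bq p q | t ∈ T ∧ (Nrq t : ℝ) = k}.ncard : ℚ) / 2

/-- The optimal multiplicity `θ'_T(k)`: half the number of primitive `t ∈ T` with `Nr t = k`. -/
noncomputable def thetaOpt (T : Set (Bq p q)) (k : ℝ) : ℚ :=
  ({t : Bq p q | Primitive T t ∧ (Nrq t : ℝ) = k}.ncard : ℚ) / 2

end GrossPaper

open GrossPaper


namespace GrossPf

variable {p q : ℕ}

def dt (s t : Bq p q) : ℚ := p * (s.imI * t.imI) + q * (s.imJ * t.imJ) + p * q * (s.imK * t.imK)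

def cr (s t : Bq p q) : Bq p q :=
  ⟨0, q * (s.imJ * t.imK - s.imK * t.imJ), p * (s.imK * t.imI - s.imI * t.imK),
    s.imI * t.imJ - s.imJ * t.imI⟩

def vol (r s t : Bq p q) : ℚ := dt r (cr s t)

lemma nr_eq (t : Bq p q) : Nrq t = t.re ^ 2 + dt t t := by
  simp [Nrq, dt]; ring

lemma nr_pure {t : Bq p q} (h : t.re = 0) : Nrq t = dt t t := by
  rw [nr_eq, h]; ring

lemma mul_pure {s t : Bq p q} (hs : s.re = 0) (ht : t.re = 0) :
    s * t = algebraMap ℚ (Bq p q) (-(dt s t)) + cr s t := by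
  ext <;> simp [dt, cr, hs, ht] <;> ring

lemma cr_re (s t : Bq p q) : (cr s t).re = 0 := rfl

lemma nr_mul (s t : Bq p q) : Nrq (s * t) = Nrq s * Nrq t := by
  simp [Nrq]; ring

lemma cramer (x y z t : Bq p q) (ht : t.re = 0) (hx : x.re = 0) (hy : y.re = 0) (hz : z.re = 0) :
    vol x y z • t = dt t (cr y z) • x + dt t (cr z x) • y + dt t (cr x y) • z := by
  ext <;> simp [vol, dt, cr, ht, hx, hy, hz] <;> ring

lemma dt_pos (hp : 0 < p) (hq : 0 < q) {t : Bq p q} (ht : t.re = 0) (h0 : t ≠ 0) : 0 < dt t t := by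
  have hp' : (0:ℚ) < p := by exact_mod_cast hp
  have hq' : (0:ℚ) < q := by exact_mod_cast hq
  by_contra hn
  have h1 : (0:ℚ) ≤ p * (t.imI * t.imI) := mul_nonneg hp'.le (mul_self_nonneg _)
  have h2 : (0:ℚ) ≤ q * (t.imJ * t.imJ) := mul_nonneg hq'.le (mul_self_nonneg _)
  have h3 : (0:ℚ) ≤ p * q * (t.imK * t.imK) := mul_nonneg (mul_pos hp' hq').le (mul_self_nonneg _)
  unfold dt at hn
  have e1 : (p:ℚ) * (t.imI * t.imI) = 0 := by linarith
  have e2 : (q:ℚ) * (t.imJ * t.imJ) = 0 := by linarith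
  have e3 : (p:ℚ) * q * (t.imK * t.imK) = 0 := by linarith
  apply h0
  ext
  · exact ht
  · simpa [hp'.ne'] using e1
  · simpa [hq'.ne'] using e2
  · simpa [hp'.ne', hq'.ne'] using e3

/-- cross relations -/
structure Cross (t1 t2 t3 : Bq p q) (a b c u v w : ℤ) : Prop where
  r1 : t1.re = 0
  r2 : t2.re = 0
  r3 : t3.re = 0
  c1 : cr t2 t3 = (2 * a : ℚ) • t1 + (w : ℚ) • t2 + (v : ℚ) • t3
  c2 : cr t3 t1 = (w : ℚ) • t1 + (2 * b : ℚ) • t2 + (u : ℚ) • t3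
  c3 : cr t1 t2 = (v : ℚ) • t1 + (u : ℚ) • t2 + (2 * c : ℚ) • t3
  v0 : vol t1 t2 t3 ≠ 0

lemma Cross.perm {t1 t2 t3 : Bq p q} {a b c u v w : ℤ} (h : Cross t1 t2 t3 a b c u v w) :
    Cross t2 t3 t1 b c a v w u where
  r1 := h.r2
  r2 := h.r3
  r3 := h.r1
  c1 := by rw [h.c2]; abel
  c2 := by rw [h.c3]; abel
  c3 := by rw [h.c1]; abel
  v0 := by
    have := h.v0
    intro h'; apply this; rw [← h']; simp [vol, dt, cr]; ring

lemma Cross.g11 {t1 t2 t3 : Bq p q} {a b c u v w : ℤ} (h : Cross t1 t2 t3 a b c u v w) :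
    dt t1 t1 = 4 * b * c - u ^ 2 := by
  have key : dt t1 (cr (cr t3 t1) (cr t1 t2)) = vol t1 t2 t3 * dt t1 t1 := by
    simp [vol, dt, cr]; ring
  rw [h.c2, h.c3] at key
  apply mul_left_cancel₀ h.v0
  rw [← key]
  simp [vol, dt, cr]; ring

lemma Cross.g12 {t1 t2 t3 : Bq p q} {a b c u v w : ℤ} (h : Cross t1 t2 t3 a b c u v w) :
    dt t1 t2 = u * v - 2 * c * w := by
  have key : dt t2 (cr (cr t3 t1) (cr t1 t2)) = vol t1 t2 t3 * dt t1 t2 := by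
    simp [vol, dt, cr]; ring
  rw [h.c2, h.c3] at key
  apply mul_left_cancel₀ h.v0
  rw [← key]
  simp [vol, dt, cr]; ring

lemma dt_comm (s t : Bq p q) : dt s t = dt t s := by simp [dt]; ring
lemma cr_anti (s t : Bq p q) : cr s t = - cr t s := by ext <;> simp [cr] <;> ring

/-- half-shifted element -/
def ee (u : ℤ) (t : Bq p q) : Bq p q := (1/2 : ℚ) • (algebraMap ℚ (Bq p q) u + t)

lemma ee_ext {x y : Bq p q} (h : ∀ f : Bq p q →ₗ[ℚ] ℚ, f x = f y) : x = y := by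
  ext
  · exact h ⟨⟨fun x => x.re, by simp⟩, by simp⟩
  · exact h ⟨⟨fun x => x.imI, by simp⟩, by simp⟩
  · exact h ⟨⟨fun x => x.imJ, by simp⟩, by simp⟩
  · exact h ⟨⟨fun x => x.imK, by simp⟩, by simp⟩

lemma ee_mul {u v : ℤ} {s t : Bq p q} (hs : s.re = 0) (ht : t.re = 0) :
    ee u s * ee v t = (1/4 : ℚ) • ((u * v - dt s t : ℚ) • (1 : Bq p q) + (u:ℚ) • t + (v:ℚ) • s + cr s t) := by
  ext <;> simp [ee, dt, cr, hs, ht] <;> ring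

lemma Cross.m11 {t1 t2 t3 : Bq p q} {a b c u v w : ℤ} (h : Cross t1 t2 t3 a b c u v w) :
    ee u t1 * ee u t1 = u • ee u t1 - (b * c) • (1 : Bq p q) := by
  rw [ee_mul h.r1 h.r1, h.g11]
  ext <;> simp [ee, cr, h.r1] <;> ring

lemma Cross.m12 {t1 t2 t3 : Bq p q} {a b c u v w : ℤ} (h : Cross t1 t2 t3 a b c u v w) :
    ee u t1 * ee v t2 = c • ee w t3 + v • ee u t1 + u • ee v t2 - (u * v) • (1 : Bq p q) := by
  rw [ee_mul h.r1 h.r2, h.g12, h.c3]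
  ext <;> simp [ee, h.r1, h.r2, h.r3] <;> ring

lemma Cross.m21 {t1 t2 t3 : Bq p q} {a b c u v w : ℤ} (h : Cross t1 t2 t3 a b c u v w) :
    ee v t2 * ee u t1 = (c * w) • (1 : Bq p q) - c • ee w t3 := by
  rw [ee_mul h.r2 h.r1, dt_comm, h.g12, cr_anti, h.c3]
  ext <;> simp [ee, h.r1, h.r2, h.r3] <;> ring

def LL (t1 t2 t3 : Bq p q) (u v w : ℤ) : Submodule ℤ (Bq p q) :=
  Submodule.span ℤ {1, ee u t1, ee v t2, ee w t3}

lemma LL_perm (t1 t2 t3 : Bq p q) (u v w : ℤ) : LL t2 t3 t1 v w u = LL t1 t2 t3 u v w := by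
  unfold LL; congr 1; ext; simp; tauto

lemma one_mem_LL (t1 t2 t3 : Bq p q) (u v w : ℤ) : (1 : Bq p q) ∈ LL t1 t2 t3 u v w :=
  Submodule.subset_span (by simp)
lemma e1_mem_LL (t1 t2 t3 : Bq p q) (u v w : ℤ) : ee u t1 ∈ LL t1 t2 t3 u v w :=
  Submodule.subset_span (by simp)
lemma e2_mem_LL (t1 t2 t3 : Bq p q) (u v w : ℤ) : ee v t2 ∈ LL t1 t2 t3 u v w :=
  Submodule.subset_span (by simp)
lemma e3_mem_LL (t1 t2 t3 : Bq p q) (u v w : ℤ) : ee w t3 ∈ LL t1 t2 t3 u v w :=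
  Submodule.subset_span (by simp)

lemma Cross.m11_mem {t1 t2 t3 : Bq p q} {a b c u v w : ℤ} (h : Cross t1 t2 t3 a b c u v w) :
    ee u t1 * ee u t1 ∈ LL t1 t2 t3 u v w := by
  rw [h.m11]
  exact sub_mem (Submodule.smul_mem _ _ (e1_mem_LL _ _ _ _ _ _)) (Submodule.smul_mem _ _ (one_mem_LL _ _ _ _ _ _))

lemma Cross.m12_mem {t1 t2 t3 : Bq p q} {a b c u v w : ℤ} (h : Cross t1 t2 t3 a b c u v w) :
    ee u t1 * ee v t2 ∈ LL t1 t2 t3 u v w := by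
  rw [h.m12]
  exact sub_mem (add_mem (add_mem (Submodule.smul_mem _ _ (e3_mem_LL _ _ _ _ _ _))
    (Submodule.smul_mem _ _ (e1_mem_LL _ _ _ _ _ _))) (Submodule.smul_mem _ _ (e2_mem_LL _ _ _ _ _ _)))
    (Submodule.smul_mem _ _ (one_mem_LL _ _ _ _ _ _))

lemma Cross.m21_mem {t1 t2 t3 : Bq p q} {a b c u v w : ℤ} (h : Cross t1 t2 t3 a b c u v w) :
    ee v t2 * ee u t1 ∈ LL t1 t2 t3 u v w := by
  rw [h.m21]
  exact sub_mem (Submodule.smul_mem _ _ (one_mem_LL _ _ _ _ _ _)) (Submodule.smul_mem _ _ (e3_mem_LL _ _ _ _ _ _))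

lemma Cross.mul_mem {t1 t2 t3 : Bq p q} {a b c u v w : ℤ} (h : Cross t1 t2 t3 a b c u v w)
    (x y : Bq p q) (hx : x ∈ LL t1 t2 t3 u v w) (hy : y ∈ LL t1 t2 t3 u v w) :
    x * y ∈ LL t1 t2 t3 u v w := by
  have hh : LL t1 t2 t3 u v w * LL t1 t2 t3 u v w ≤ LL t1 t2 t3 u v w := by
    conv_lhs => unfold LL
    rw [Submodule.span_mul_span, Submodule.span_le]
    rintro _ ⟨r, hr, s, hs, rfl⟩
    simp only [Set.mem_insert_iff, Set.mem_singleton_iff] at hr hs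
    have p1 := LL_perm t1 t2 t3 u v w
    have p2 := LL_perm t2 t3 t1 v w u
    have h' := h.perm
    have h'' := h'.perm
    rw [p1] at p2
    simp only [SetLike.mem_coe]
    rcases hr with rfl | rfl | rfl | rfl <;> rcases hs with rfl | rfl | rfl | rfl <;>
    (try simp only [one_mul, mul_one])
    · exact one_mem_LL _ _ _ _ _ _
    · exact e1_mem_LL _ _ _ _ _ _
    · exact e2_mem_LL _ _ _ _ _ _
    · exact e3_mem_LL _ _ _ _ _ _
    · exact e1_mem_LL _ _ _ _ _ _
    · exact h.m11_mem
    · exact h.m12_mem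
    · exact p2 ▸ h''.m21_mem
    · exact e2_mem_LL _ _ _ _ _ _
    · exact h.m21_mem
    · exact p1 ▸ h'.m11_mem
    · exact p1 ▸ h'.m12_mem
    · exact e3_mem_LL _ _ _ _ _ _
    · exact p2 ▸ h''.m12_mem
    · exact p1 ▸ h'.m21_mem
    · exact p2 ▸ h''.m11_mem
  exact hh (Submodule.mul_mem_mul hx hy)

def ordOf {t1 t2 t3 : Bq p q} {a b c u v w : ℤ} (h : Cross t1 t2 t3 a b c u v w) :
    Subring (Bq p q) :=
  ((LL t1 t2 t3 u v w).toSubalgebra (one_mem_LL _ _ _ _ _ _) h.mul_mem).toSubring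

lemma mem_ordOf {t1 t2 t3 : Bq p q} {a b c u v w : ℤ} (h : Cross t1 t2 t3 a b c u v w)
    (x : Bq p q) : x ∈ ordOf h ↔ x ∈ LL t1 t2 t3 u v w := Iff.rfl

lemma finrank_Bq : Module.finrank ℚ (Bq p q) = 4 := QuaternionAlgebra.finrank_eq_four ..

lemma isOrder_ordOf {t1 t2 t3 : Bq p q} {a b c u v w : ℤ} (h : Cross t1 t2 t3 a b c u v w)
    (hs : Submodule.span ℚ (ordOf h : Set (Bq p q)) = ⊤) : IsOrder (ordOf h) := by
  refine ⟨?_, hs⟩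
  let f : Fin 4 → Bq p q := ![1, ee u t1, ee v t2, ee w t3]
  have hr : Set.range f = {1, ee u t1, ee v t2, ee w t3} := by
    simp only [f, Matrix.range_cons, Matrix.range_empty, Set.union_empty]; rfl
  have hf : LinearIndependent ℚ f := by
    apply linearIndependent_of_top_le_span_of_card_eq_finrank
    · rw [← hs, Submodule.span_le]
      intro x hx
      have hx : x ∈ LL t1 t2 t3 u v w := hx
      rw [LL, ← hr] at hx
      exact Submodule.span_subset_span ℤ ℚ _ hx
    · simp [finrank_Bq]
  have hf' : LinearIndependent ℤ f := hf.restrict_scalars' ℤ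
  have B := Module.Basis.span hf'
  rw [hr] at B
  exact ⟨B⟩

end GrossPf

namespace GrossPf

variable {p q : ℕ}

lemma ee_re (u : ℤ) (t : Bq p q) : (ee u t).re = (u + t.re) / 2 := by simp [ee]; ring
lemma ee_imI (u : ℤ) (t : Bq p q) : (ee u t).imI = t.imI / 2 := by simp [ee]; ring
lemma ee_imJ (u : ℤ) (t : Bq p q) : (ee u t).imJ = t.imJ / 2 := by simp [ee]; ring
lemma ee_imK (u : ℤ) (t : Bq p q) : (ee u t).imK = t.imK / 2 := by simp [ee]; ring

def Good (O : Subring (Bq p q)) (t1 t2 t3 : Bq p q) (a b c u v w : ℤ) : Prop :=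
  Cross t1 t2 t3 a b c u v w ∧ ∀ x, x ∈ O ↔ x ∈ LL t1 t2 t3 u v w

lemma Good.perm {O : Subring (Bq p q)} {t1 t2 t3 : Bq p q} {a b c u v w : ℤ}
    (h : Good O t1 t2 t3 a b c u v w) : Good O t2 t3 t1 b c a v w u :=
  ⟨h.1.perm, fun x => by rw [h.2, LL_perm t1 t2 t3]⟩

lemma Good.step {O : Subring (Bq p q)} (hO : IsMaximalOrder O) {t1 t2 t3 : Bq p q}
    {a b c u v w : ℤ} (h : Good O t1 t2 t3 a b c u v w)
    {s1 s2 s3 : Bq p q} {a' b' c' u' v' w' : ℤ} (h' : Cross s1 s2 s3 a' b' c' u' v' w')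
    (h1 : ee u t1 ∈ LL s1 s2 s3 u' v' w') (h2 : ee v t2 ∈ LL s1 s2 s3 u' v' w')
    (h3 : ee w t3 ∈ LL s1 s2 s3 u' v' w') : Good O s1 s2 s3 a' b' c' u' v' w' := by
  refine ⟨h', ?_⟩
  have hle : O ≤ ordOf h' := by
    intro x hx
    rw [h.2] at hx
    rw [mem_ordOf]
    have : LL t1 t2 t3 u v w ≤ LL s1 s2 s3 u' v' w' := by
      conv_lhs => unfold LL
      rw [Submodule.span_le]
      rintro y hy
      simp only [Set.mem_insert_iff, Set.mem_singleton_iff] at hy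
      rcases hy with rfl | rfl | rfl | rfl
      · exact one_mem_LL _ _ _ _ _ _
      · exact h1
      · exact h2
      · exact h3
    exact this hx
  have hord : IsOrder (ordOf h') := by
    apply isOrder_ordOf
    rw [eq_top_iff, ← hO.1.2]
    exact Submodule.span_mono hle
  have := hO.2 _ hord hle
  intro x
  rw [← mem_ordOf h', this]

lemma Cross.shear3 {t1 t2 t3 : Bq p q} {a b c u v w : ℤ}
    (h : Cross t1 t2 t3 a b c u v w) (m n : ℤ) :
    Cross (t1 - (m:ℚ) • t3) (t2 - (n:ℚ) • t3) t3 a b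
      (a * m^2 + b * n^2 + c + u * n + v * m + w * m * n)
      (u + 2 * b * n + w * m) (v + 2 * a * m + w * n) w where
  r1 := by simp [h.r1, h.r3]
  r2 := by simp [h.r2, h.r3]
  r3 := h.r3
  c1 := by
    have e : cr (t2 - (n:ℚ) • t3) t3 = cr t2 t3 := by ext <;> simp [cr, -mul_eq_mul_left_iff] <;> ring
    rw [e, h.c1]; push_cast; module
  c2 := by
    have e : cr t3 (t1 - (m:ℚ) • t3) = cr t3 t1 := by ext <;> simp [cr, -mul_eq_mul_left_iff] <;> ring
    rw [e, h.c2]; push_cast; module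
  c3 := by
    have e : cr (t1 - (m:ℚ) • t3) (t2 - (n:ℚ) • t3) = cr t1 t2 + (n:ℚ) • cr t3 t1 + (m:ℚ) • cr t2 t3 := by
      ext <;> simp [cr, -mul_eq_mul_left_iff] <;> ring
    rw [e, h.c1, h.c2, h.c3]; push_cast; module
  v0 := by
    have := h.v0
    intro h'; apply this; rw [← h']; simp [vol, dt, cr]; ring

lemma Good.shear3 {O : Subring (Bq p q)} (hO : IsMaximalOrder O) {t1 t2 t3 : Bq p q}
    {a b c u v w : ℤ} (h : Good O t1 t2 t3 a b c u v w) (m n : ℤ) :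
    Good O (t1 - (m:ℚ) • t3) (t2 - (n:ℚ) • t3) t3 a b
      (a * m^2 + b * n^2 + c + u * n + v * m + w * m * n)
      (u + 2 * b * n + w * m) (v + 2 * a * m + w * n) w := by
  refine h.step hO (h.1.shear3 m n) ?_ ?_ (e3_mem_LL _ _ _ _ _ _)
  · have : ee u t1 = ee (u + 2 * b * n + w * m) (t1 - (m:ℚ) • t3) + m • ee w t3
        - (b * n + w * m) • (1 : Bq p q) := by
      ext <;> simp [ee_re, ee_imI, ee_imJ, ee_imK] <;> ring
    rw [this]
    exact sub_mem (add_mem (e1_mem_LL _ _ _ _ _ _) (Submodule.smul_mem _ _ (e3_mem_LL _ _ _ _ _ _)))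
      (Submodule.smul_mem _ _ (one_mem_LL _ _ _ _ _ _))
  · have : ee v t2 = ee (v + 2 * a * m + w * n) (t2 - (n:ℚ) • t3) + n • ee w t3
        - (a * m + w * n) • (1 : Bq p q) := by
      ext <;> simp [ee_re, ee_imI, ee_imJ, ee_imK] <;> ring
    rw [this]
    exact sub_mem (add_mem (e2_mem_LL _ _ _ _ _ _) (Submodule.smul_mem _ _ (e3_mem_LL _ _ _ _ _ _)))
      (Submodule.smul_mem _ _ (one_mem_LL _ _ _ _ _ _))

lemma Cross.shear2 {t1 t2 t3 : Bq p q} {a b c u v w : ℤ}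
    (h : Cross t1 t2 t3 a b c u v w) (m : ℤ) :
    Cross t1 (t2 - (m:ℚ) • t1) t3 (a + b * m^2 + w * m) b c u (v + u * m) (w + 2 * b * m) where
  r1 := h.r1
  r2 := by simp [h.r2, h.r1]
  r3 := h.r3
  c1 := by
    have e : cr (t2 - (m:ℚ) • t1) t3 = cr t2 t3 + (m:ℚ) • cr t3 t1 := by ext <;> simp [cr, -mul_eq_mul_left_iff] <;> ring
    rw [e, h.c1, h.c2]; push_cast; module
  c2 := by
    rw [h.c2]; push_cast; module
  c3 := by
    have e : cr t1 (t2 - (m:ℚ) • t1) = cr t1 t2 := by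
      ext <;> simp [cr, -mul_eq_mul_left_iff] <;> ring
    rw [e, h.c3]; push_cast; module
  v0 := by
    have := h.v0
    intro h'; apply this; rw [← h']; simp [vol, dt, cr]; ring

lemma Good.shear2 {O : Subring (Bq p q)} (hO : IsMaximalOrder O) {t1 t2 t3 : Bq p q}
    {a b c u v w : ℤ} (h : Good O t1 t2 t3 a b c u v w) (m : ℤ) :
    Good O t1 (t2 - (m:ℚ) • t1) t3 (a + b * m^2 + w * m) b c u (v + u * m) (w + 2 * b * m) := by
  refine h.step hO (h.1.shear2 m) (e1_mem_LL _ _ _ _ _ _) ?_ ?_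
  · have : ee v t2 = ee (v + u * m) (t2 - (m:ℚ) • t1) + m • ee u t1
        - (u * m) • (1 : Bq p q) := by
      ext <;> simp [ee_re, ee_imI, ee_imJ, ee_imK] <;> ring
    rw [this]
    exact sub_mem (add_mem (e2_mem_LL _ _ _ _ _ _) (Submodule.smul_mem _ _ (e1_mem_LL _ _ _ _ _ _)))
      (Submodule.smul_mem _ _ (one_mem_LL _ _ _ _ _ _))
  · have : ee w t3 = ee (w + 2 * b * m) t3 - (b * m) • (1 : Bq p q) := by
      ext <;> simp [ee_re, ee_imI, ee_imJ, ee_imK] <;> ring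
    rw [this]
    exact sub_mem (e3_mem_LL _ _ _ _ _ _)
      (Submodule.smul_mem _ _ (one_mem_LL _ _ _ _ _ _))

lemma LL_coord {t1 t2 t3 : Bq p q} {u v w : ℤ} {x : Bq p q} (hx : x ∈ LL t1 t2 t3 u v w) :
    ∃ n : ℤ, dt x (cr t3 t1) = n / 2 * vol t1 t2 t3 := by
  unfold LL at hx
  induction hx using Submodule.span_induction with
  | mem x hx =>
    simp only [Set.mem_insert_iff, Set.mem_singleton_iff] at hx
    rcases hx with rfl | rfl | rfl | rfl
    · exact ⟨0, by simp [dt]⟩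
    · exact ⟨0, by simp [dt, ee, cr]; ring⟩
    · exact ⟨1, by simp [dt, ee, cr, vol]; ring⟩
    · exact ⟨0, by simp [dt, ee, cr]; ring⟩
  | zero => exact ⟨0, by simp [dt]⟩
  | add x y _ _ hx hy =>
    obtain ⟨m, hm⟩ := hx
    obtain ⟨n, hn⟩ := hy
    refine ⟨m + n, ?_⟩
    have : dt (x + y) (cr t3 t1) = dt x (cr t3 t1) + dt y (cr t3 t1) := by simp [dt]; ring
    rw [this, hm, hn]; push_cast; ring
  | smul k x _ hx =>
    obtain ⟨m, hm⟩ := hx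
    refine ⟨k * m, ?_⟩
    have : dt (k • x) (cr t3 t1) = k * dt x (cr t3 t1) := by simp [dt]; ring
    rw [this, hm]; push_cast; ring

lemma Good.no_div {O : Subring (Bq p q)} {t1 t2 t3 : Bq p q}
    {a b c u v w : ℤ} (h : Good O t1 t2 t3 a b c u v w) (l : ℤ) (hl : 1 < l) (v' : ℤ)
    (hx : ee v' ((l:ℚ)⁻¹ • t2) ∈ O) : False := by
  rw [h.2] at hx
  obtain ⟨n, hn⟩ := LL_coord hx
  have hl0 : (l:ℚ) ≠ 0 := by exact_mod_cast (by omega : l ≠ 0)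
  have e : dt (ee v' ((l:ℚ)⁻¹ • t2)) (cr t3 t1) = (l:ℚ)⁻¹ / 2 * vol t1 t2 t3 := by
    simp [dt, ee, cr, vol]; ring
  rw [e] at hn
  have := mul_right_cancel₀ h.1.v0 hn
  field_simp at this
  have h2 : l * n = 1 := by exact_mod_cast this.symm
  have := Int.eq_one_or_neg_one_of_mul_eq_one h2
  omega

lemma Good.kind2 {O : Subring (Bq p q)} (hO : IsMaximalOrder O) {t1 t2 t3 : Bq p q}
    {a b c u v w : ℤ} (h : Good O t1 t2 t3 a b c u v w) (l : ℤ) (hl : 1 < l)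
    (ha : l ∣ a) (hc : l ∣ c) (hv : l ∣ v) : False := by
  obtain ⟨a, rfl⟩ := ha
  obtain ⟨c, rfl⟩ := hc
  obtain ⟨v, rfl⟩ := hv
  have hl0 : (l:ℚ) ≠ 0 := by exact_mod_cast (by omega : l ≠ 0)
  have hC : Cross t1 ((l:ℚ)⁻¹ • t2) t3 a (l * b) c u v w :=
    { r1 := h.1.r1
      r2 := by simp [h.1.r2]
      r3 := h.1.r3
      c1 := by
        have e : cr ((l:ℚ)⁻¹ • t2) t3 = (l:ℚ)⁻¹ • cr t2 t3 := by ext <;> simp [cr, -mul_eq_mul_left_iff] <;> ring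
        rw [e, h.1.c1]; push_cast; match_scalars <;> field_simp
      c2 := by
        rw [h.1.c2]; push_cast; match_scalars <;> field_simp
      c3 := by
        have e : cr t1 ((l:ℚ)⁻¹ • t2) = (l:ℚ)⁻¹ • cr t1 t2 := by ext <;> simp [cr, -mul_eq_mul_left_iff] <;> ring
        rw [e, h.1.c3]; push_cast; match_scalars <;> field_simp
      v0 := by
        have := h.1.v0
        have e : vol t1 ((l:ℚ)⁻¹ • t2) t3 = (l:ℚ)⁻¹ * vol t1 t2 t3 := by simp [vol, dt, cr]; ring
        rw [e]; exact mul_ne_zero (inv_ne_zero hl0) this }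
  have hG := h.step hO hC (e1_mem_LL _ _ _ _ _ _) (by
    have : ee (l * v) t2 = l • ee v ((l:ℚ)⁻¹ • t2) := by
      ext <;> simp [ee_re, ee_imI, ee_imJ, ee_imK] <;> field_simp
    rw [this]
    exact Submodule.smul_mem _ _ (e2_mem_LL _ _ _ _ _ _)) (e3_mem_LL _ _ _ _ _ _)
  exact h.no_div l hl v ((hG.2 _).2 (e2_mem_LL _ _ _ _ _ _))

lemma Good.kind1 {O : Subring (Bq p q)} (hO : IsMaximalOrder O) {t1 t2 t3 : Bq p q}
    {a b c u v w : ℤ} (h : Good O t1 t2 t3 a b c u v w) (l : ℤ) (hl : 1 < l)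
    (hc : l ^ 2 ∣ c) (hu : l ∣ u) (hv : l ∣ v) : False := by
  obtain ⟨u, rfl⟩ := hu
  obtain ⟨c, rfl⟩ := hc
  obtain ⟨v, rfl⟩ := hv
  have hl0 : (l:ℚ) ≠ 0 := by exact_mod_cast (by omega : l ≠ 0)
  have hC : Cross ((l:ℚ)⁻¹ • t1) ((l:ℚ)⁻¹ • t2) t3 a b c u v w :=
    { r1 := by simp [h.1.r1]
      r2 := by simp [h.1.r2]
      r3 := h.1.r3
      c1 := by
        have e : cr ((l:ℚ)⁻¹ • t2) t3 = (l:ℚ)⁻¹ • cr t2 t3 := by ext <;> simp [cr, -mul_eq_mul_left_iff] <;> ring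
        rw [e, h.1.c1]; push_cast; match_scalars <;> field_simp
      c2 := by
        have e : cr t3 ((l:ℚ)⁻¹ • t1) = (l:ℚ)⁻¹ • cr t3 t1 := by ext <;> simp [cr, -mul_eq_mul_left_iff] <;> ring
        rw [e, h.1.c2]; push_cast; match_scalars <;> field_simp
      c3 := by
        have e : cr ((l:ℚ)⁻¹ • t1) ((l:ℚ)⁻¹ • t2) = ((l:ℚ)⁻¹ * (l:ℚ)⁻¹) • cr t1 t2 := by
          ext <;> simp [cr, -mul_eq_mul_left_iff] <;> ring
        rw [e, h.1.c3]; push_cast; match_scalars <;> field_simp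
      v0 := by
        have := h.1.v0
        have e : vol ((l:ℚ)⁻¹ • t1) ((l:ℚ)⁻¹ • t2) t3 = (l:ℚ)⁻¹ * ((l:ℚ)⁻¹ * vol t1 t2 t3) := by
          simp [vol, dt, cr]; ring
        rw [e]; exact mul_ne_zero (inv_ne_zero hl0) (mul_ne_zero (inv_ne_zero hl0) this) }
  have hG := h.step hO hC (by
    have : ee (l * u) t1 = l • ee u ((l:ℚ)⁻¹ • t1) := by
      ext <;> simp [ee_re, ee_imI, ee_imJ, ee_imK] <;> field_simp
    rw [this]
    exact Submodule.smul_mem _ _ (e1_mem_LL _ _ _ _ _ _)) (by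
    have : ee (l * v) t2 = l • ee v ((l:ℚ)⁻¹ • t2) := by
      ext <;> simp [ee_re, ee_imI, ee_imJ, ee_imK] <;> field_simp
    rw [this]
    exact Submodule.smul_mem _ _ (e2_mem_LL _ _ _ _ _ _)) (e3_mem_LL _ _ _ _ _ _)
  exact h.no_div l hl v ((hG.2 _).2 (e2_mem_LL _ _ _ _ _ _))

lemma Good.aniso {O : Subring (Bq p q)} (hO : IsMaximalOrder O) {t1 t2 t3 : Bq p q}
    {a b c u v w : ℤ} (h : Good O t1 t2 t3 a b c u v w) (l : ℕ) (hl : l.Prime)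
    (hc : (l:ℤ) ∣ c) (hu : (l:ℤ) ∣ u) (hv : (l:ℤ) ∣ v) (x y : ℤ)
    (hxy : (l:ℤ) ∣ a * x ^ 2 + w * x * y + b * y ^ 2) : (l:ℤ) ∣ x ∧ (l:ℤ) ∣ y := by
  have hlp : Prime (l:ℤ) := Nat.prime_iff_prime_int.1 hl
  have h1l : (1:ℤ) < l := by exact_mod_cast hl.one_lt
  by_cases hx : (l:ℤ) ∣ x
  · refine ⟨hx, ?_⟩
    by_contra hy
    have hb : (l:ℤ) ∣ b := by
      have : (l:ℤ) ∣ b * y ^ 2 := by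
        have e : b * y ^ 2 = (a * x ^ 2 + w * x * y + b * y ^ 2) - x * (a * x + w * y) := by ring
        rw [e]; exact dvd_sub hxy (Dvd.dvd.mul_right hx _)
      rcases hlp.dvd_or_dvd this with h | h
      · exact h
      · exact absurd (hlp.dvd_of_dvd_pow h) hy
    exact h.perm.perm.kind2 hO l h1l hc hb hu
  · exfalso
    obtain ⟨r, s, hrs⟩ : ∃ r s : ℤ, r * x + s * l = 1 := by
      have : IsCoprime x (l:ℤ) := ((Prime.coprime_iff_not_dvd hlp).2 hx).symm
      exact this
    refine (h.shear2 hO (r * y)).kind2 hO l h1l ?_ hc (dvd_add hv (Dvd.dvd.mul_right hu _))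
    have e : a + b * (r * y) ^ 2 + w * (r * y) =
        r ^ 2 * (a * x ^ 2 + w * x * y + b * y ^ 2) +
        l * (s * (a * (1 + r * x) + w * r * y)) := by
      have : s * l = 1 - r * x := by linarith
      have e2 : (l:ℤ) * (s * (a * (1 + r * x) + w * r * y)) = (s * l) * (a * (1 + r * x) + w * r * y) := by ring
      rw [e2, this]; ring
    rw [e]
    exact dvd_add (Dvd.dvd.mul_left hxy _) (Dvd.intro _ rfl)

lemma radical2 : ∀ (a b c u v w : ZMod 2),
    4 * a * b * c + u * v * w - a * u ^ 2 - b * v ^ 2 - c * w ^ 2 = 0 →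
      ∃ x y z, ¬(x = 0 ∧ y = 0 ∧ z = 0) ∧ 2 * a * x + w * y + v * z = 0 ∧
            w * x + 2 * b * y + u * z = 0 ∧ v * x + u * y + 2 * c * z = 0 ∧
            a * x ^ 2 + b * y ^ 2 + c * z ^ 2 + u * y * z + v * x * z + w * x * y = 0 := by
  decide

lemma radical (l : ℕ) (hl : l.Prime) (a b c u v w : ℤ)
    (hN : (l:ℤ) ∣ 4 * a * b * c + u * v * w - a * u ^ 2 - b * v ^ 2 - c * w ^ 2) :
    ∃ x y z : ℤ, ¬ ((l:ℤ) ∣ x ∧ (l:ℤ) ∣ y ∧ (l:ℤ) ∣ z) ∧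
      (l:ℤ) ∣ 2 * a * x + w * y + v * z ∧ (l:ℤ) ∣ w * x + 2 * b * y + u * z ∧
      (l:ℤ) ∣ v * x + u * y + 2 * c * z ∧
      (l:ℤ) ∣ a * x ^ 2 + b * y ^ 2 + c * z ^ 2 + u * y * z + v * x * z + w * x * y := by
  have : Fact l.Prime := ⟨hl⟩
  have hN' : ((4 * a * b * c + u * v * w - a * u ^ 2 - b * v ^ 2 - c * w ^ 2 : ℤ) : ZMod l) = 0 :=
    (ZMod.intCast_zmod_eq_zero_iff_dvd _ _).2 hN
  suffices H : ∃ x y z : ZMod l, ¬ (x = 0 ∧ y = 0 ∧ z = 0) ∧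
      2 * (a:ZMod l) * x + w * y + v * z = 0 ∧ (w:ZMod l) * x + 2 * b * y + u * z = 0 ∧
      (v:ZMod l) * x + u * y + 2 * c * z = 0 ∧
      (a:ZMod l) * x ^ 2 + b * y ^ 2 + c * z ^ 2 + u * y * z + v * x * z + w * x * y = 0 by
    obtain ⟨x, y, z, h0, h1, h2, h3, h4⟩ := H
    obtain ⟨x, rfl⟩ := ZMod.intCast_surjective x
    obtain ⟨y, rfl⟩ := ZMod.intCast_surjective y
    obtain ⟨z, rfl⟩ := ZMod.intCast_surjective z
    refine ⟨x, y, z, ?_, ?_, ?_, ?_, ?_⟩ <;>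
    simp only [← ZMod.intCast_zmod_eq_zero_iff_dvd] <;> push_cast <;> assumption
  push_cast at hN'
  generalize (a : ZMod l) = a at *
  generalize (b : ZMod l) = b at *
  generalize (c : ZMod l) = c at *
  generalize (u : ZMod l) = u at *
  generalize (v : ZMod l) = v at *
  generalize (w : ZMod l) = w at *
  rcases hl.eq_two_or_odd' with rfl | hodd
  · exact radical2 a b c u v w hN'
  · have hdet : (!![2 * a, w, v; w, 2 * b, u; v, u, 2 * c] : Matrix (Fin 3) (Fin 3) (ZMod l)).det = 0 := by
      rw [Matrix.det_fin_three]
      simp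
      linear_combination 2 * hN'
    obtain ⟨x, hx0, hx⟩ := Matrix.exists_mulVec_eq_zero_iff.2 hdet
    have h1 := congrFun hx 0
    have h2 := congrFun hx 1
    have h3 := congrFun hx 2
    simp [Matrix.mulVec, dotProduct, Fin.sum_univ_three] at h1 h2 h3
    have two : (2 : ZMod l) ≠ 0 := by
      intro h
      have h : ((2:ℕ) : ZMod l) = 0 := by exact_mod_cast h
      rw [ZMod.natCast_eq_zero_iff] at h
      have := (Nat.prime_dvd_prime_iff_eq hl Nat.prime_two).1 h
      subst this; exact absurd hodd (by decide)
    refine ⟨x 0, x 1, x 2, ?_, h1, h2, h3, ?_⟩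
    · rintro ⟨a, b, c⟩
      apply hx0; ext i; fin_cases i <;> simp [a, b, c]
    · apply mul_left_cancel₀ two
      linear_combination x 0 * h1 + x 1 * h2 + x 2 * h3

end GrossPf

namespace GrossPf
open Polynomial

lemma hensel_sq (l : ℕ) [Fact l.Prime] (m s : ℤ)
    (h : ‖((s ^ 2 - m : ℤ) : ℤ_[l])‖ < ‖((2 * s : ℤ) : ℤ_[l])‖ ^ 2) : ∃ x : ℤ_[l], x ^ 2 = m := by
  let F : ℤ_[l][X] := X ^ 2 - C (m : ℤ_[l])
  have h1 : F.aeval (s : ℤ_[l]) = ((s ^ 2 - m : ℤ) : ℤ_[l]) := by simp [F]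
  have h2 : F.derivative.aeval (s : ℤ_[l]) = ((2 * s : ℤ) : ℤ_[l]) := by
    simp [F]
    left; norm_num
  have := hensels_lemma (F := F) (a := (s : ℤ_[l])) (by rw [h1, h2]; exact h)
  obtain ⟨z, hz, -⟩ := this
  refine ⟨z, ?_⟩
  simp [F] at hz
  linear_combination hz

lemma sq_odd (l : ℕ) [Fact l.Prime] (hl2 : l ≠ 2) (m s : ℤ) (hm : ¬ (l:ℤ) ∣ m)
    (h : (l:ℤ) ∣ s ^ 2 - m) : ∃ x : ℤ_[l], x ^ 2 = m := by
  have hl : l.Prime := Fact.out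
  have hlp : Prime (l:ℤ) := Nat.prime_iff_prime_int.1 hl
  apply hensel_sq l m s
  have h1 : ‖((s ^ 2 - m : ℤ) : ℤ_[l])‖ < 1 := by
    rw [PadicInt.norm_int_lt_one_iff_dvd]; exact h
  have h2 : ‖((2 * s : ℤ) : ℤ_[l])‖ = 1 := by
    apply le_antisymm (PadicInt.norm_le_one _)
    by_contra hlt
    push Not at hlt
    rw [PadicInt.norm_int_lt_one_iff_dvd] at hlt
    rcases hlp.dvd_or_dvd hlt with h' | h'
    · have : l ∣ 2 := by exact_mod_cast h'
      exact hl2 ((Nat.prime_dvd_prime_iff_eq hl Nat.prime_two).1 this)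
    · apply hm
      have e : m = s ^ 2 - (s ^ 2 - m) := by ring
      rw [e]
      exact dvd_sub (dvd_pow h' (by norm_num)) h
  rw [h2]; simpa using h1

instance fact2 : Fact (Nat.Prime 2) := ⟨Nat.prime_two⟩

lemma sq_two (m : ℤ) (h : m % 8 = 1) : ∃ x : ℤ_[2], x ^ 2 = m := by
  apply hensel_sq 2 m 1
  have h1 : ‖((1 ^ 2 - m : ℤ) : ℤ_[2])‖ ≤ (2:ℕ) ^ (-((3:ℕ):ℤ)) := by
    rw [PadicInt.norm_int_le_pow_iff_dvd]
    push_cast; omega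
  have h2 : ‖((2 * 1 : ℤ) : ℤ_[2])‖ = 2⁻¹ := by
    have := PadicInt.norm_p (p := 2)
    simpa using this
  rw [h2]
  refine lt_of_le_of_lt h1 ?_
  norm_num

/-- isotropy of the norm form at `l ≠ p` -/
lemma iso_norm (p q : ℕ) (hp : p.Prime) (hodd : Odd p) (hq : q.Prime)
    (hq8 : q % 8 = 3) (hqr : ∃ r : ℤ, (q : ℤ) ∣ r ^ 2 + p) (l : ℕ) [Fact l.Prime] (hlp : l ≠ p) :
    ∃ x y z : ℚ_[l], ¬ (x = 0 ∧ y = 0 ∧ z = 0) ∧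
      p * (x * x) + q * (y * y) + p * q * (z * z) = 0 := by
  have hl : l.Prime := Fact.out
  have hlP : Prime (l:ℤ) := Nat.prime_iff_prime_int.1 hl
  have hp0 : (p : ℚ_[l]) ≠ 0 := by exact_mod_cast hp.ne_zero
  have hq0 : (q : ℚ_[l]) ≠ 0 := by exact_mod_cast hq.ne_zero
  have hlp' : ¬ (l:ℤ) ∣ p := by
    intro h; exact hlp ((Nat.prime_dvd_prime_iff_eq hl hp).1 (by exact_mod_cast h))
  -- generic constructions
  have conA : ∀ (m y z : ℤ), m = - p * q * (y ^ 2 + p * z ^ 2) → ¬ (y = 0 ∧ z = 0) →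
      (∃ x : ℤ_[l], x ^ 2 = m) → ∃ x y z : ℚ_[l], ¬ (x = 0 ∧ y = 0 ∧ z = 0) ∧
      p * (x * x) + q * (y * y) + p * q * (z * z) = 0 := by
    rintro m y z hm hyz ⟨x, hx⟩
    have hx' : (x : ℚ_[l]) ^ 2 = m := by exact_mod_cast congrArg (fun t : ℤ_[l] => (t : ℚ_[l])) hx
    refine ⟨x / p, y, z, ?_, ?_⟩
    · rintro ⟨-, h1, h2⟩
      exact hyz ⟨by exact_mod_cast h1, by exact_mod_cast h2⟩
    · rw [hm] at hx'
      push_cast at hx'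
      field_simp
      linear_combination hx'
  have conB : ∀ (m x z : ℤ), m = - p * q * (x ^ 2 + q * z ^ 2) → ¬ (x = 0 ∧ z = 0) →
      (∃ y : ℤ_[l], y ^ 2 = m) → ∃ x y z : ℚ_[l], ¬ (x = 0 ∧ y = 0 ∧ z = 0) ∧
      p * (x * x) + q * (y * y) + p * q * (z * z) = 0 := by
    rintro m y z hm hyz ⟨x, hx⟩
    have hx' : (x : ℚ_[l]) ^ 2 = m := by exact_mod_cast congrArg (fun t : ℤ_[l] => (t : ℚ_[l])) hx
    refine ⟨y, x / q, z, ?_, ?_⟩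
    · rintro ⟨h1, -, h2⟩
      exact hyz ⟨by exact_mod_cast h1, by exact_mod_cast h2⟩
    · rw [hm] at hx'
      push_cast at hx'
      field_simp
      linear_combination hx'
  by_cases hl2 : l = 2
  · subst hl2
    have aux : ∀ y z : ℤ, (- p * q * (y ^ 2 + p * z ^ 2)) % 8 =
        (- (p % 8 : ℤ) * 3 * (y ^ 2 + (p % 8 : ℤ) * z ^ 2)) % 8 := by
      intro y z
      have h1 : (p:ℤ) ≡ (p % 8 : ℤ) [ZMOD 8] := (Int.mod_modEq _ _).symm
      have h2 : (q:ℤ) ≡ 3 [ZMOD 8] := by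
        unfold Int.ModEq; omega
      exact Int.ModEq.mul (Int.ModEq.mul h1.neg h2) (Int.ModEq.add rfl (h1.mul rfl))
    have h4 : (p % 8 : ℤ) = 1 ∨ (p % 8 : ℤ) = 3 ∨ (p % 8 : ℤ) = 5 ∨ (p % 8 : ℤ) = 7 := by
      obtain ⟨k, rfl⟩ := hodd; omega
    rcases h4 with h | h | h | h
    · exact conA _ 1 2 rfl (by norm_num) (sq_two _ (by rw [aux, h]; norm_num))
    · exact conA _ 2 1 rfl (by norm_num) (sq_two _ (by rw [aux, h]; norm_num))
    · exact conA _ 1 0 rfl (by norm_num) (sq_two _ (by rw [aux, h]; norm_num))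
    · exact conA _ 2 1 rfl (by norm_num) (sq_two _ (by rw [aux, h]; norm_num))
  by_cases hlq : l = q
  · subst hlq
    obtain ⟨r, hr⟩ := hqr
    obtain ⟨s, hs⟩ := sq_odd l hl2 (-p) r (by rwa [dvd_neg]) (by simpa using hr)
    have hs' : (s : ℚ_[l]) ^ 2 = -p := by exact_mod_cast congrArg (fun t : ℤ_[l] => (t : ℚ_[l])) hs
    refine ⟨0, s, 1, by simp, ?_⟩
    linear_combination (l : ℚ_[l]) * hs'
  have hlq' : ¬ (l:ℤ) ∣ q := by
    intro h; exact hlq ((Nat.prime_dvd_prime_iff_eq hl hq).1 (by exact_mod_cast h))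
  have hpz : (p : ZMod l) ≠ 0 := by
    intro h; apply hlp'; rw [← ZMod.intCast_zmod_eq_zero_iff_dvd]; exact_mod_cast h
  have hqz : (q : ZMod l) ≠ 0 := by
    intro h; apply hlq'; rw [← ZMod.intCast_zmod_eq_zero_iff_dvd]; exact_mod_cast h
  obtain ⟨x, y, hxy⟩ : ∃ x y : ZMod l, (p:ZMod l) * x ^ 2 + q * y ^ 2 + p * q = 0 := by
    have := FiniteField.exists_root_sum_quadratic (R := ZMod l) (f := C (p : ZMod l) * X ^ 2)
      (g := C (q : ZMod l) * X ^ 2 + C ((p:ZMod l) * q)) (by compute_degree!)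
      (by compute_degree!) (by
        rw [ZMod.card]; exact Nat.odd_iff.1 (hl.odd_of_ne_two hl2))
    obtain ⟨a, b, hab⟩ := this
    refine ⟨a, b, ?_⟩
    simp at hab
    linear_combination hab
  obtain ⟨x, rfl⟩ := ZMod.intCast_surjective x
  obtain ⟨y, rfl⟩ := ZMod.intCast_surjective y
  have hd : (l:ℤ) ∣ p * x ^ 2 + q * y ^ 2 + p * q := by
    rw [← ZMod.intCast_zmod_eq_zero_iff_dvd]; push_cast; exact hxy
  by_cases hx : (l:ℤ) ∣ x
  · by_cases hy : (l:ℤ) ∣ y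
    · exfalso
      have : (l:ℤ) ∣ p * q := by
        have e : (p:ℤ) * q = (p * x ^ 2 + q * y ^ 2 + p * q) - x * (p * x) - y * (q * y) := by ring
        rw [e]
        exact dvd_sub (dvd_sub hd (Dvd.dvd.mul_right hx _)) (Dvd.dvd.mul_right hy _)
      rcases hlP.dvd_or_dvd this with h | h
      · exact hlp' h
      · exact hlq' h
    · refine conB _ x 1 rfl (by norm_num) ?_
      have h1 : (l:ℤ) ∣ (q * y) ^ 2 - (- p * q * (x ^ 2 + q * 1 ^ 2)) := by
        have e : (q * y) ^ 2 - (- p * q * (x ^ 2 + q * 1 ^ 2)) = (p * x ^ 2 + q * y ^ 2 + p * q) * (q:ℤ) := by ring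
        rw [e]; exact Dvd.dvd.mul_right hd _
      refine sq_odd l hl2 _ (q * y) ?_ h1
      intro h2
      have := hlP.dvd_of_dvd_pow ((dvd_sub_left h2).1 h1)
      rcases hlP.dvd_or_dvd this with h | h
      · exact hlq' h
      · exact hy h
  · refine conA _ y 1 rfl (by norm_num) ?_
    have h1 : (l:ℤ) ∣ (p * x) ^ 2 - (- p * q * (y ^ 2 + p * 1 ^ 2)) := by
      have e : (p * x) ^ 2 - (- p * q * (y ^ 2 + p * 1 ^ 2)) = (p * x ^ 2 + q * y ^ 2 + p * q) * (p:ℤ) := by ring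
      rw [e]; exact Dvd.dvd.mul_right hd _
    refine sq_odd l hl2 _ (p * x) ?_ h1
    intro h2
    have := hlP.dvd_of_dvd_pow ((dvd_sub_left h2).1 h1)
    rcases hlP.dvd_or_dvd this with h | h
    · exact hlp' h
    · exact hx h

end GrossPf

namespace GrossPf

variable {p q : ℕ}

lemma iso_Q (hp : p.Prime) (hodd : Odd p) (hq : q.Prime)
    (hq8 : q % 8 = 3) (hqr : ∃ r : ℤ, (q : ℤ) ∣ r ^ 2 + p) (l : ℕ) [Fact l.Prime] (hlp : l ≠ p)
    {t1 t2 t3 : Bq p q} {a b c u v w : ℤ} (h : Cross t1 t2 t3 a b c u v w) :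
    ∃ x y z : ℚ_[l], ¬ (x = 0 ∧ y = 0 ∧ z = 0) ∧
      a * x ^ 2 + b * y ^ 2 + c * z ^ 2 + u * y * z + v * x * z + w * x * y = 0 := by
  obtain ⟨X, Y, Z, hn, h0⟩ := iso_norm p q hp hodd hq hq8 hqr l hlp
  have hv := h.v0
  have c1 := h.c1
  have c2 := h.c2
  have c3 := h.c3
  rw [QuaternionAlgebra.ext_iff] at c1 c2 c3
  simp only [cr, QuaternionAlgebra.re_add, QuaternionAlgebra.imI_add, QuaternionAlgebra.imJ_add, QuaternionAlgebra.imK_add, QuaternionAlgebra.imI_smul, QuaternionAlgebra.imJ_smul, QuaternionAlgebra.imK_smul, smul_eq_mul] at c1 c2 c3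
  obtain ⟨-, c1i, c1j, c1k⟩ := c1
  obtain ⟨-, c2i, c2j, c2k⟩ := c2
  obtain ⟨-, c3i, c3j, c3k⟩ := c3
  simp only [vol, dt, cr] at hv
  generalize t1.imI = I1 at *
  generalize t1.imJ = J1 at *
  generalize t1.imK = K1 at *
  generalize t2.imI = I2 at *
  generalize t2.imJ = J2 at *
  generalize t2.imK = K2 at *
  generalize t3.imI = I3 at *
  generalize t3.imJ = J3 at *
  generalize t3.imK = K3 at *
  apply_fun (fun r : ℚ => (r : ℚ_[l])) at c1i c1j c1k c2i c2j c2k c3i c3j c3k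
  push_cast at c1i c1j c1k c2i c2j c2k c3i c3j c3k
  have hv' : ((p * (I1 * (q * (J2 * K3 - K2 * J3))) + q * (J1 * (p * (K2 * I3 - I2 * K3))) +
      p * q * (K1 * (I2 * J3 - J2 * I3)) : ℚ) : ℚ_[l]) ≠ 0 := by exact_mod_cast hv
  push_cast at hv'
  set V : ℚ_[l] := _ with hV
  change V ≠ 0 at hv'
  have e : ∀ (i j k : ℚ_[l]), True := fun _ _ _ => trivial
  let D : ℚ_[l] → ℚ_[l] → ℚ_[l] → ℚ_[l] := fun i j k => p * i * X + q * j * Y + p * q * k * Z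
  have hD : ∀ i j k, D i j k = p * i * X + q * j * Y + p * q * k * Z := fun _ _ _ => rfl
  have d1 := hD I1 J1 K1
  have d2 := hD I2 J2 K2
  have d3 := hD I3 J3 K3
  set X1 := D I1 J1 K1
  set X2 := D I2 J2 K2
  set X3 := D I3 J3 K3
  clear_value X1 X2 X3 V
  refine ⟨X1, X2, X3, ?_, ?_⟩
  · rintro ⟨rfl, rfl, rfl⟩
    apply hn
    refine ⟨?_, ?_, ?_⟩ <;> apply (mul_eq_zero.1 (?_ : V * _ = 0)).resolve_left hv' <;> rw [hV]
    · linear_combination -q * (J2 * K3 - K2 * J3) * d1 - q * (J3 * K1 - K3 * J1) * d2 - q * (J1 * K2 - K1 * J2) * d3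
    · linear_combination -p * (K2 * I3 - I2 * K3) * d1 - p * (K3 * I1 - I3 * K1) * d2 - p * (K1 * I2 - I1 * K2) * d3
    · linear_combination - (I2 * J3 - J2 * I3) * d1 - (I3 * J1 - J3 * I1) * d2 - (I1 * J2 - J1 * I2) * d3
  · have r1 : 2 * a * X1 + w * X2 + v * X3 = p * (q * (J2 * K3 - K2 * J3)) * X + q * (p * (K2 * I3 - I2 * K3)) * Y + p * q * (I2 * J3 - J2 * I3) * Z := by
      rw [d1, d2, d3]
      linear_combination - p * X * c1i - q * Y * c1j - p * q * Z * c1k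
    have r2 : w * X1 + 2 * b * X2 + u * X3 = p * (q * (J3 * K1 - K3 * J1)) * X + q * (p * (K3 * I1 - I3 * K1)) * Y + p * q * (I3 * J1 - J3 * I1) * Z := by
      rw [d1, d2, d3]
      linear_combination - p * X * c2i - q * Y * c2j - p * q * Z * c2k
    have r3 : v * X1 + u * X2 + 2 * c * X3 = p * (q * (J1 * K2 - K1 * J2)) * X + q * (p * (K1 * I2 - I1 * K2)) * Y + p * q * (I1 * J2 - J1 * I2) * Z := by
      rw [d1, d2, d3]
      linear_combination - p * X * c3i - q * Y * c3j - p * q * Z * c3k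
    have r4 : X1 * (p * (q * (J2 * K3 - K2 * J3)) * X + q * (p * (K2 * I3 - I2 * K3)) * Y + p * q * (I2 * J3 - J2 * I3) * Z) + X2 * (p * (q * (J3 * K1 - K3 * J1)) * X + q * (p * (K3 * I1 - I3 * K1)) * Y + p * q * (I3 * J1 - J3 * I1) * Z) + X3 * (p * (q * (J1 * K2 - K1 * J2)) * X + q * (p * (K1 * I2 - I1 * K2)) * Y + p * q * (I1 * J2 - J1 * I2) * Z) = V * (p * (X * X) + q * (Y * Y) + p * q * (Z * Z)) := by
      rw [d1, d2, d3, hV]; ring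
    rw [h0, mul_zero] at r4
    linear_combination (1/2 : ℚ_[l]) * (X1 * r1 + X2 * r2 + X3 * r3 + r4)

lemma scale (l : ℕ) [Fact l.Prime] (a b c u v w : ℤ)
    (h : ∃ x y z : ℚ_[l], ¬ (x = 0 ∧ y = 0 ∧ z = 0) ∧
      a * x ^ 2 + b * y ^ 2 + c * z ^ 2 + u * y * z + v * x * z + w * x * y = 0) :
    ∃ x y z : ℤ_[l], ¬ ((l : ℤ_[l]) ∣ x ∧ (l : ℤ_[l]) ∣ y ∧ (l : ℤ_[l]) ∣ z) ∧
      a * x ^ 2 + b * y ^ 2 + c * z ^ 2 + u * y * z + v * x * z + w * x * y = 0 := by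
  obtain ⟨x, y, z, hn, h⟩ := h
  obtain ⟨m, hm0, hx, hy, hz, hm⟩ : ∃ m : ℚ_[l], m ≠ 0 ∧ ‖x‖ ≤ ‖m‖ ∧ ‖y‖ ≤ ‖m‖ ∧ ‖z‖ ≤ ‖m‖ ∧
      (m = x ∨ m = y ∨ m = z) := by
    obtain ⟨m, hx, hy, hz, hm⟩ : ∃ m : ℚ_[l], ‖x‖ ≤ ‖m‖ ∧ ‖y‖ ≤ ‖m‖ ∧ ‖z‖ ≤ ‖m‖ ∧
      (m = x ∨ m = y ∨ m = z) := by
      rcases le_total ‖x‖ ‖y‖ with h1 | h1 <;> rcases le_total ‖y‖ ‖z‖ with h2 | h2 <;>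
        rcases le_total ‖x‖ ‖z‖ with h3 | h3
      · exact ⟨z, h3, h2, le_rfl, by simp⟩
      · exact ⟨z, h1.trans h2, h2, le_rfl, by simp⟩
      · exact ⟨y, h1, le_rfl, h2, by simp⟩
      · exact ⟨y, h1, le_rfl, h2, by simp⟩
      · exact ⟨z, h3, h2, le_rfl, by simp⟩
      · exact ⟨x, le_rfl, h1, h3, by simp⟩
      · exact ⟨x, le_rfl, h1, h2.trans h1, by simp⟩
      · exact ⟨x, le_rfl, h1, h3, by simp⟩
    refine ⟨m, ?_, hx, hy, hz, hm⟩
    rintro rfl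
    apply hn
    simp only [norm_zero, norm_le_zero_iff] at hx hy hz
    exact ⟨hx, hy, hz⟩
  have key : ∀ t : ℚ_[l], ‖t‖ ≤ ‖m‖ → ∃ s : ℤ_[l], (s : ℚ_[l]) = t / m := by
    intro t ht
    have h1 : ‖t / m‖ ≤ 1 := by
      rw [norm_div]
      exact div_le_one_of_le₀ ht (norm_nonneg _)
    exact ⟨⟨t / m, h1⟩, rfl⟩
  obtain ⟨x', hx'⟩ := key x hx
  obtain ⟨y', hy'⟩ := key y hy
  obtain ⟨z', hz'⟩ := key z hz
  refine ⟨x', y', z', ?_, ?_⟩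
  · rintro ⟨h1, h2, h3⟩
    rw [← PadicInt.norm_lt_one_iff_dvd, PadicInt.norm_def] at h1 h2 h3
    simp only [hx', hy', hz', norm_div] at h1 h2 h3
    have : ‖m‖ / ‖m‖ = 1 := div_self (by simpa using hm0)
    rcases hm with rfl | rfl | rfl <;> linarith
  · apply Subtype.ext
    push_cast
    rw [hx', hy', hz']
    field_simp
    linear_combination h

lemma lt_dvd (l : ℕ) [Fact l.Prime] (x : ℤ_[l]) : ∃ n : ℤ, (l : ℤ_[l]) ∣ x - n := by
  refine ⟨x.zmodRepr, ?_⟩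
  rw [← PadicInt.norm_lt_one_iff_dvd]
  exact_mod_cast PadicInt.norm_sub_zmodRepr_lt_one x

lemma int_dvd (l : ℕ) [Fact l.Prime] (n : ℤ) : (l : ℤ_[l]) ∣ n ↔ (l:ℤ) ∣ n := by
  rw [← PadicInt.norm_lt_one_iff_dvd, PadicInt.norm_int_lt_one_iff_dvd]

lemma no_iso {O : Subring (Bq p q)} (hO : IsMaximalOrder O) (hp : p.Prime) (hodd : Odd p) (hq : q.Prime)
    (hq8 : q % 8 = 3) (hqr : ∃ r : ℤ, (q : ℤ) ∣ r ^ 2 + p) (l : ℕ) (hl : l.Prime) (hlp : l ≠ p)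
    {t1 t2 t3 : Bq p q} {a b c u v w : ℤ} (h : Good O t1 t2 t3 a b c u v w)
    (hc : (l:ℤ) ∣ c) (hu : (l:ℤ) ∣ u) (hv : (l:ℤ) ∣ v) (hcc : ¬ (l:ℤ)^2 ∣ c) : False := by
  have : Fact l.Prime := ⟨hl⟩
  have hlP : Prime (l : ℤ_[l]) := PadicInt.prime_p
  obtain ⟨x, y, z, hn, h0⟩ := scale l a b c u v w (iso_Q hp hodd hq hq8 hqr l hlp h.1)
  obtain ⟨m, hm⟩ := lt_dvd l x
  obtain ⟨n, hn'⟩ := lt_dvd l y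
  have hc' := (int_dvd l c).2 hc
  have hu' := (int_dvd l u).2 hu
  have hv' := (int_dvd l v).2 hv
  have hd : (l:ℤ) ∣ a * m ^ 2 + w * m * n + b * n ^ 2 := by
    rw [← int_dvd]
    obtain ⟨r, hr⟩ := hm
    obtain ⟨s, hs⟩ := hn'
    obtain ⟨c', hc'⟩ := hc'
    obtain ⟨u', hu'⟩ := hu'
    obtain ⟨v', hv'⟩ := hv'
    have hx : x = m + l * r := by linear_combination hr
    have hy : y = n + l * s := by linear_combination hs
    rw [hx, hy, hc', hu', hv'] at h0
    push_cast
    refine ⟨-(c' * z ^ 2 + u' * (n + l * s) * z + v' * (m + l * r) * z + a * (2 * m * r + l * r ^ 2)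
      + b * (2 * n * s + l * s ^ 2) + w * (m * s + r * n + l * r * s)), ?_⟩
    linear_combination h0
  obtain ⟨dm, dn⟩ := h.aniso hO l hl hc hu hv m n hd
  rw [← int_dvd] at dm dn
  have hx : (l : ℤ_[l]) ∣ x := by simpa using dvd_add hm dm
  have hy : (l : ℤ_[l]) ∣ y := by simpa using dvd_add hn' dn
  apply hn
  refine ⟨hx, hy, ?_⟩
  obtain ⟨c1, rfl⟩ := hc
  obtain ⟨x, rfl⟩ := hx
  obtain ⟨y, rfl⟩ := hy
  obtain ⟨u, rfl⟩ := hu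
  obtain ⟨v, rfl⟩ := hv
  push_cast at h0
  have hl0 := hlP.ne_zero
  have h1 : (l : ℤ_[l]) ∣ c1 * z ^ 2 := by
    refine ⟨-(a * x ^ 2 + b * y ^ 2 + u * y * z + v * x * z + w * x * y), ?_⟩
    apply mul_left_cancel₀ hl0
    linear_combination h0
  rcases hlP.dvd_or_dvd h1 with h2 | h2
  · rw [int_dvd] at h2
    exact absurd (by rw [pow_two]; exact mul_dvd_mul_left _ h2) hcc
  · exact hlP.dvd_of_dvd_pow h2

end GrossPf

namespace GrossPf

variable {p q : ℕ}

def NN (a b c u v w : ℤ) : ℤ := 4 * a * b * c + u * v * w - a * u ^ 2 - b * v ^ 2 - c * w ^ 2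

lemma local0 {O : Subring (Bq p q)} (hO : IsMaximalOrder O) (hp : p.Prime) (hodd : Odd p) (hq : q.Prime)
    (hq8 : q % 8 = 3) (hqr : ∃ r : ℤ, (q : ℤ) ∣ r ^ 2 + p) (l : ℕ) (hl : l.Prime)
    {t1 t2 t3 : Bq p q} {a b c u v w : ℤ} (h : Good O t1 t2 t3 a b c u v w)
    (hc : (l:ℤ) ∣ c) (hu : (l:ℤ) ∣ u) (hv : (l:ℤ) ∣ v) : l = p ∧ ¬ (l:ℤ)^2 ∣ NN a b c u v w := by
  have hlP : Prime (l:ℤ) := Nat.prime_iff_prime_int.1 hl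
  have h1l : (1:ℤ) < l := by exact_mod_cast hl.one_lt
  have hcc : ¬ (l:ℤ)^2 ∣ c := fun hcc => h.kind1 hO l h1l hcc hu hv
  have hlp : l = p := by
    by_contra hlp
    exact no_iso hO hp hodd hq hq8 hqr l hl hlp h hc hu hv hcc
  refine ⟨hlp, fun hN => ?_⟩
  have h4 : (l:ℤ) ∣ 4 * a * b - w ^ 2 := by
    have hc' := hc
    obtain ⟨c', rfl⟩ := hc
    obtain ⟨u', rfl⟩ := hu
    obtain ⟨v', rfl⟩ := hv
    obtain ⟨k, hk⟩ := hN
    have h5 : (l:ℤ) ∣ c' * (4 * a * b - w ^ 2) := by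
      refine ⟨k - (u' * v' * w - a * u' ^ 2 - b * v' ^ 2), ?_⟩
      apply mul_left_cancel₀ hlP.ne_zero
      unfold NN at hk
      linear_combination hk
    refine (hlP.dvd_or_dvd h5).resolve_left fun h6 => hcc ?_
    rw [pow_two]; exact mul_dvd_mul_left _ h6
  obtain ⟨-, h2a⟩ := h.aniso hO l hl hc hu hv (-w) (2 * a) (by
    obtain ⟨k, hk⟩ := h4
    exact ⟨a * k, by linear_combination a * hk⟩)
  have ha : (l:ℤ) ∣ a := by
    refine (hlP.dvd_or_dvd h2a).resolve_left fun h6 => ?_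
    have h7 : l ∣ 2 := by exact_mod_cast h6
    have h8 := (Nat.prime_dvd_prime_iff_eq hl Nat.prime_two).1 h7
    rw [← hlp, h8] at hodd
    exact absurd hodd (by decide)
  obtain ⟨h9, -⟩ := h.aniso hO l hl hc hu hv 1 0 (by simpa using ha)
  exact hlP.not_unit (isUnit_of_dvd_one h9)

lemma local1 {O : Subring (Bq p q)} (hO : IsMaximalOrder O) (hp : p.Prime) (hodd : Odd p) (hq : q.Prime)
    (hq8 : q % 8 = 3) (hqr : ∃ r : ℤ, (q : ℤ) ∣ r ^ 2 + p) (l : ℕ) (hl : l.Prime)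
    {t1 t2 t3 : Bq p q} {a b c u v w : ℤ} (h : Good O t1 t2 t3 a b c u v w)
    (x y z : ℤ) (hz : ¬ (l:ℤ) ∣ z)
    (h1 : (l:ℤ) ∣ 2 * a * x + w * y + v * z) (h2 : (l:ℤ) ∣ w * x + 2 * b * y + u * z)
    (h3 : (l:ℤ) ∣ a * x ^ 2 + b * y ^ 2 + c * z ^ 2 + u * y * z + v * x * z + w * x * y) :
    l = p ∧ ¬ (l:ℤ)^2 ∣ NN a b c u v w := by
  have hlP : Prime (l:ℤ) := Nat.prime_iff_prime_int.1 hl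
  obtain ⟨α, k, hk⟩ := (hlP.coprime_iff_not_dvd).2 hz
  have hg := h.shear3 hO (k * x) (k * y)
  have e : NN a b (a * (k*x)^2 + b * (k*y)^2 + c + u * (k*y) + v * (k*x) + w * (k*x) * (k*y))
      (u + 2 * b * (k*y) + w * (k*x)) (v + 2 * a * (k*x) + w * (k*y)) w = NN a b c u v w := by
    unfold NN; ring
  rw [← e]
  obtain ⟨r1, h1⟩ := h1
  obtain ⟨r2, h2⟩ := h2
  obtain ⟨r3, h3⟩ := h3
  refine local0 hO hp hodd hq hq8 hqr l hl hg ?_ ?_ ?_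
  · refine ⟨k ^ 2 * r3 + α * (c * (1 + k * z) + u * (k * y) + v * (k * x)), ?_⟩
    linear_combination k ^ 2 * h3 - (c * (1 + k * z) + u * (k * y) + v * (k * x)) * hk
  · exact ⟨k * r2 + α * u, by linear_combination k * h2 - u * hk⟩
  · exact ⟨k * r1 + α * v, by linear_combination k * h1 - v * hk⟩

lemma local2 {O : Subring (Bq p q)} (hO : IsMaximalOrder O) (hp : p.Prime) (hodd : Odd p) (hq : q.Prime)
    (hq8 : q % 8 = 3) (hqr : ∃ r : ℤ, (q : ℤ) ∣ r ^ 2 + p) (l : ℕ) (hl : l.Prime)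
    {t1 t2 t3 : Bq p q} {a b c u v w : ℤ} (h : Good O t1 t2 t3 a b c u v w)
    (hN : (l:ℤ) ∣ NN a b c u v w) :
    l = p ∧ ¬ (l:ℤ)^2 ∣ NN a b c u v w := by
  obtain ⟨x, y, z, hn, h1, h2, h3, h4⟩ := radical l hl a b c u v w hN
  by_cases hz : (l:ℤ) ∣ z
  · by_cases hy : (l:ℤ) ∣ y
    · by_cases hx : (l:ℤ) ∣ x
      · exact absurd ⟨hx, hy, hz⟩ hn
      · have e : NN b c a v w u = NN a b c u v w := by unfold NN; ring
        rw [← e]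
        refine local1 hO hp hodd hq hq8 hqr l hl h.perm y z x hx ?_ ?_ ?_
        · convert h2 using 1; ring
        · convert h3 using 1; ring
        · convert h4 using 1; ring
    · have e : NN c a b w u v = NN a b c u v w := by unfold NN; ring
      rw [← e]
      refine local1 hO hp hodd hq hq8 hqr l hl h.perm.perm z x y hy ?_ ?_ ?_
      · convert h3 using 1; ring
      · convert h1 using 1; ring
      · convert h4 using 1; ring
  · exact local1 hO hp hodd hq hq8 hqr l hl h x y z hz h1 h2 h4

lemma Cross.vol_sq {t1 t2 t3 : Bq p q} {a b c u v w : ℤ} (h : Cross t1 t2 t3 a b c u v w) :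
    vol t1 t2 t3 = 2 * NN a b c u v w := by
  have k1 : vol t1 t2 t3 = 2 * a * dt t1 t1 + w * dt t1 t2 + v * dt t1 t3 := by
    unfold vol; rw [h.c1]; simp [dt]; ring
  have k2 : dt t1 t3 = w * u - 2 * b * v := by rw [dt_comm]; exact h.perm.perm.g12
  rw [k1, h.g11, h.g12, k2]
  unfold NN; push_cast; ring

lemma global_N {O : Subring (Bq p q)} (hO : IsMaximalOrder O) (hp : p.Prime) (hodd : Odd p) (hq : q.Prime)
    (hq8 : q % 8 = 3) (hqr : ∃ r : ℤ, (q : ℤ) ∣ r ^ 2 + p)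
    {t1 t2 t3 : Bq p q} {a b c u v w : ℤ} (h : Good O t1 t2 t3 a b c u v w) :
    (NN a b c u v w) ^ 2 = 1 ∨ (NN a b c u v w) ^ 2 = p ^ 2 := by
  have h0 : NN a b c u v w ≠ 0 := by
    intro h0
    have := h.1.v0
    rw [h.1.vol_sq, h0] at this
    simp at this
  have hloc := fun l hl => local2 hO hp hodd hq hq8 hqr l hl h
  generalize NN a b c u v w = N at *
  rw [← Int.natAbs_sq N]
  by_cases h1 : N.natAbs = 1
  · left; rw [h1]; norm_num
  · right
    congr 2
    obtain ⟨l, hl, hd⟩ := Nat.exists_prime_and_dvd h1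
    have h2 := hloc l hl (Int.natCast_dvd.2 hd)
    obtain ⟨rfl, hsq⟩ := h2
    obtain ⟨k, hk⟩ := hd
    by_cases hk1 : k = 1
    · rw [hk, hk1, mul_one]
    · exfalso
      obtain ⟨l', hl', hd'⟩ := Nat.exists_prime_and_dvd hk1
      obtain ⟨rfl, -⟩ := hloc l' hl' (Int.natCast_dvd.2 (hk ▸ dvd_mul_of_dvd_right hd' _))
      apply hsq
      have : (l' ^ 2) ∣ N.natAbs := by rw [hk, pow_two]; exact mul_dvd_mul_left _ hd'
      exact_mod_cast Int.natCast_dvd.2 this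

end GrossPf

namespace GrossPf

variable {p q : ℕ}

lemma rat_int (ρ : ℚ) (d : ℤ) (hd : d ≠ 0) (h : ∀ n : ℕ, ∃ k : ℤ, (d:ℚ) * ρ ^ n = k) :
    ∃ k : ℤ, ρ = k := by
  have key : ∀ n : ℕ, ρ.den ^ n ∣ d.natAbs := by
    intro n
    obtain ⟨k, hk⟩ := h n
    have h1 : (d : ℚ) * ρ.num ^ n = k * ρ.den ^ n := by
      conv_lhs at hk => rw [← Rat.num_div_den ρ]
      rw [div_pow] at hk
      have : (ρ.den : ℚ) ≠ 0 := by exact_mod_cast ρ.den_nz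
      field_simp at hk
      linear_combination hk
    have h2 : d * ρ.num ^ n = k * (ρ.den : ℤ) ^ n := by exact_mod_cast h1
    have h3 : (ρ.den ^ n) ∣ (d * ρ.num ^ n).natAbs := by
      rw [h2, Int.natAbs_mul, Int.natAbs_pow, Int.natAbs_natCast]
      exact dvd_mul_left _ _
    rw [Int.natAbs_mul, Int.natAbs_pow] at h3
    exact (Nat.Coprime.pow n n ρ.reduced.symm).dvd_of_dvd_mul_right h3
  have h1 : ρ.den = 1 := by
    by_contra hne
    have h2 : 1 < ρ.den := by have := ρ.den_nz; omega
    have h3 := Nat.le_of_dvd (Int.natAbs_pos.2 hd) (key d.natAbs)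
    exact absurd (Nat.lt_pow_self h2 (n := d.natAbs)) (by omega)
  exact ⟨ρ.num, ((Rat.den_eq_one_iff ρ).1 h1).symm⟩

lemma order_den {O : Subring (Bq p q)} (hO : IsOrder O) : ∃ d : ℤ, d ≠ 0 ∧ ∀ x ∈ O,
    ∃ n1 n2 n3 n4 : ℤ, d * x.re = n1 ∧ d * x.imI = n2 ∧ d * x.imJ = n3 ∧ d * x.imK = n4 := by
  obtain ⟨⟨B⟩, -⟩ := hO
  let f : Fin 4 × Fin 4 → ℚ := fun i =>
    ![(B i.1 : Bq p q).re, (B i.1 : Bq p q).imI, (B i.1 : Bq p q).imJ, (B i.1 : Bq p q).imK] i.2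
  obtain ⟨⟨d, hd⟩, h⟩ := IsLocalization.exist_integer_multiples_of_finite (nonZeroDivisors ℤ) f
  refine ⟨d, nonZeroDivisors.ne_zero hd, ?_⟩
  have key : ∀ g : Bq p q →ₗ[ℚ] ℚ, (∀ i, ∃ n : ℤ, d * g (B i) = n) → ∀ x ∈ O, ∃ n : ℤ, d * g x = n := by
    intro g hg x hx
    choose n hn using hg
    have hB := B.sum_repr ⟨x, hx⟩
    have hB' : ∑ i, (B.repr ⟨x, hx⟩ i : ℚ) • (B i : Bq p q) = x := by
      have := congrArg (fun t : O => (t : Bq p q)) hB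
      simp only [AddSubmonoidClass.coe_finsetSum] at this
      refine Eq.trans ?_ this
      refine Finset.sum_congr rfl fun i _ => ?_
      rw [Int.cast_smul_eq_zsmul]; simp
    refine ⟨∑ i, B.repr ⟨x, hx⟩ i * n i, ?_⟩
    conv_lhs => rw [← hB']
    rw [map_sum, Finset.mul_sum]
    push_cast
    refine Finset.sum_congr rfl fun i _ => ?_
    rw [map_smul, ← hn, smul_eq_mul]; ring
  have hf : ∀ i j, ∃ n : ℤ, (d:ℚ) * f (i, j) = n := by
    intro i j
    obtain ⟨n, hn⟩ := h (i, j)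
    refine ⟨n, ?_⟩
    rw [Algebra.smul_def] at hn
    simpa using hn.symm
  intro x hx
  obtain ⟨n1, h1⟩ := key ⟨⟨fun x => x.re, by simp⟩, by simp⟩ (fun i => hf i 0) x hx
  obtain ⟨n2, h2⟩ := key ⟨⟨fun x => x.imI, by simp⟩, by simp⟩ (fun i => hf i 1) x hx
  obtain ⟨n3, h3⟩ := key ⟨⟨fun x => x.imJ, by simp⟩, by simp⟩ (fun i => hf i 2) x hx
  obtain ⟨n4, h4⟩ := key ⟨⟨fun x => x.imK, by simp⟩, by simp⟩ (fun i => hf i 3) x hx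
  exact ⟨n1, n2, n3, n4, h1, h2, h3, h4⟩

lemma nr_pow (x : Bq p q) (n : ℕ) : Nrq (x ^ n) = Nrq x ^ n := by
  induction n with
  | zero => simp [Nrq]
  | succ n ih => rw [pow_succ, pow_succ, nr_mul, ih]

lemma nr_int {O : Subring (Bq p q)} (hO : IsOrder O) {x : Bq p q} (hx : x ∈ O) :
    ∃ n : ℤ, Nrq x = n := by
  obtain ⟨d, hd, h⟩ := order_den hO
  apply rat_int (Nrq x) (d ^ 2) (pow_ne_zero 2 hd)
  intro n
  obtain ⟨n1, n2, n3, n4, h1, h2, h3, h4⟩ := h (x ^ n) (pow_mem hx n)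
  rw [← nr_pow, nr_eq]
  refine ⟨n1 ^ 2 + p * (n2 * n2) + q * (n3 * n3) + p * q * (n4 * n4), ?_⟩
  push_cast
  rw [← h1, ← h2, ← h3, ← h4]
  simp only [dt]; ring

lemma tr_int {O : Subring (Bq p q)} (hO : IsOrder O) {x : Bq p q} (hx : x ∈ O) :
    ∃ n : ℤ, Trq x = n := by
  obtain ⟨m, hm⟩ := nr_int hO hx
  obtain ⟨n, hn⟩ := nr_int hO (add_mem hx (one_mem O))
  refine ⟨n - m - 1, ?_⟩
  push_cast
  rw [← hm, ← hn]
  simp [nr_eq, Trq, dt]; ring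

lemma rat_mem_int {O : Subring (Bq p q)} (hO : IsOrder O) {r : ℚ}
    (hx : algebraMap ℚ (Bq p q) r ∈ O) : ∃ n : ℤ, r = n := by
  obtain ⟨d, hd, h⟩ := order_den hO
  apply rat_int r d hd
  intro n
  obtain ⟨n1, n2, n3, n4, h1, h2, h3, h4⟩ := h _ (pow_mem hx n)
  refine ⟨n1, ?_⟩
  rw [← h1, ← map_pow]
  generalize r ^ n = s
  simp

lemma int_mem (O : Subring (Bq p q)) (n : ℤ) : algebraMap ℚ (Bq p q) n ∈ O := by
  simp

/-- data of an element of the Gross lattice -/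
lemma gross_data {O : Subring (Bq p q)} (hO : IsOrder O) {t : Bq p q} (ht : t ∈ GrossLat O) :
    t.re = 0 ∧ (∃ r : ℤ, ee r t ∈ O) ∧ ∃ n : ℤ, dt t t = n ∧ (n % 4 = 0 ∨ n % 4 = 3) := by
  obtain ⟨x, hx, rfl⟩ := ht
  have hre : (2 * x - algebraMap ℚ (Bq p q) (Trq x)).re = 0 := by
    have e : Trq x = 2 * x.re := rfl
    rw [two_mul]; generalize Trq x = τ at *; simp; linarith
  refine ⟨hre, ?_, ?_⟩
  · obtain ⟨n, hn⟩ := tr_int hO hx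
    refine ⟨n, ?_⟩
    have : ee n (2 * x - algebraMap ℚ (Bq p q) (Trq x)) = x := by
      rw [ee, hn, two_mul]; ext <;> simp <;> ring
    rw [this]; exact hx
  · obtain ⟨n, hn⟩ := tr_int hO hx
    obtain ⟨m, hm⟩ := nr_int hO hx
    refine ⟨4 * m - n ^ 2, ?_, ?_⟩
    · push_cast
      have e : Trq x = 2 * x.re := rfl
      rw [← hn, ← hm, nr_eq, two_mul]
      generalize Trq x = τ at *
      simp [dt]; rw [e]; ring
    · have : n % 4 = 0 ∨ n % 4 = 1 ∨ n % 4 = 2 ∨ n % 4 = 3 := by omega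
      rcases this with h | h | h | h <;> simp [pow_two, Int.sub_emod, Int.mul_emod, h]

lemma gross_add {O : Subring (Bq p q)} {s t : Bq p q} (hs : s ∈ GrossLat O) (ht : t ∈ GrossLat O) :
    s + t ∈ GrossLat O := by
  obtain ⟨x, hx, rfl⟩ := hs
  obtain ⟨y, hy, rfl⟩ := ht
  refine ⟨x + y, add_mem hx hy, ?_⟩
  simp only [two_mul]
  ext <;> simp [Trq] <;> ring

lemma gross_smul {O : Subring (Bq p q)} {s : Bq p q} (n : ℤ) (hs : s ∈ GrossLat O) :
    (n : ℚ) • s ∈ GrossLat O := by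
  obtain ⟨x, hx, rfl⟩ := hs
  refine ⟨(n:ℚ) • x, ?_, ?_⟩
  · rw [Int.cast_smul_eq_zsmul]; exact zsmul_mem hx n
  · simp only [two_mul]
    ext <;> simp [Trq] <;> ring

end GrossPf

namespace GrossPf

variable {p q : ℕ}

lemma round_one (A s k : ℚ) (hA : 0 < A) :
    ∃ m : ℤ, A * (s - m) ^ 2 + 2 * k * (s - m) ≤ A / 4 - k ^ 2 / A := by
  refine ⟨round (s + k / A), ?_⟩
  have h := abs_sub_round (s + k / A)
  set m := round (s + k / A)
  have h2 : (s + k / A - m) ^ 2 ≤ 1 / 4 := by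
    have := abs_le.1 h
    nlinarith [this.1, this.2]
  have e : A * (s - m) ^ 2 + 2 * k * (s - m) = A * (s + k / A - m) ^ 2 - k ^ 2 / A := by
    field_simp; ring
  rw [e]; nlinarith

lemma babai (A B C f g h α β γ : ℚ) (hA : 0 < A) (hAB : 0 < A * B - h ^ 2) :
    ∃ m n : ℤ, A * (α - m) ^ 2 + B * (β - n) ^ 2 + C * γ ^ 2 + 2 * f * (β - n) * γ
      + 2 * g * (α - m) * γ + 2 * h * (α - m) * (β - n) ≤ A / 4 + B / 4 + C * γ ^ 2 := by
  have hB' : 0 < B - h ^ 2 / A := by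
    have : B - h ^ 2 / A = (A * B - h ^ 2) / A := by field_simp
    rw [this]; positivity
  obtain ⟨n, hn⟩ := round_one (B - h ^ 2 / A) β ((f - g * h / A) * γ) hB'
  obtain ⟨m, hm⟩ := round_one A α (h * (β - n) + g * γ) hA
  refine ⟨m, n, ?_⟩
  have e1 : 0 ≤ ((f - g * h / A) * γ) ^ 2 / (B - h ^ 2 / A) := by positivity
  have e2 : 0 ≤ h ^ 2 / A := by positivity
  have e3 : 0 ≤ (g * γ) ^ 2 / A := by positivity
  have e4 : (h * (β - n) + g * γ) ^ 2 / A = h ^ 2 / A * (β - n) ^ 2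
      + 2 * (g * h / A) * γ * (β - n) + (g * γ) ^ 2 / A := by
    field_simp; ring
  rw [e4] at hm
  linarith

def qf (x y z : Bq p q) (α β γ : ℚ) : ℚ :=
  dt x x * α ^ 2 + dt y y * β ^ 2 + dt z z * γ ^ 2 + 2 * dt y z * β * γ
      + 2 * dt x z * α * γ + 2 * dt x y * α * β

lemma qf_eq (x y z : Bq p q) (α β γ : ℚ) :
    dt (α • x + β • y + γ • z) (α • x + β • y + γ • z) = qf x y z α β γ := by
  simp [qf, dt]; ring

lemma lagr (x y : Bq p q) : dt x x * dt y y - dt x y ^ 2 = dt (cr x y) (cr x y) := by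
  simp [dt, cr]; ring

lemma li3 {x y z : Bq p q} (hxy : LinearIndependent ℚ ![x, y])
    (hzxy : z ∉ Submodule.span ℚ ({x, y} : Set (Bq p q))) :
    ∀ α β γ : ℚ, α • x + β • y + γ • z = 0 → α = 0 ∧ β = 0 ∧ γ = 0 := by
  intro α β γ h
  have hγ : γ = 0 := by
    by_contra hγ
    apply hzxy
    rw [Submodule.mem_span_pair]
    refine ⟨-α / γ, -β / γ, ?_⟩
    have : z = γ⁻¹ • (γ • z) := by rw [smul_smul, inv_mul_cancel₀ hγ, one_smul]
    rw [this, ← sub_eq_zero]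
    have e : γ • z = - (α • x + β • y) := by rw [eq_neg_iff_add_eq_zero, add_comm]; exact h
    rw [e]
    module
  subst hγ
  rw [LinearIndependent.pair_iff] at hxy
  obtain ⟨h1, h2⟩ := hxy α β (by simpa using h)
  exact ⟨h1, h2, rfl⟩

lemma vol_ne {x y z : Bq p q} (hp : 0 < p) (hq : 0 < q) (rx : x.re = 0) (ry : y.re = 0)
    (rz : z.re = 0)
    (hli : ∀ α β γ : ℚ, α • x + β • y + γ • z = 0 → α = 0 ∧ β = 0 ∧ γ = 0) :
    vol x y z ≠ 0 ∧ 0 < dt x x * dt y y - dt x y ^ 2 := by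
  have x0 : x ≠ 0 := by
    rintro rfl
    have := (hli 1 0 0 (by simp)).1
    norm_num at this
  have h1 : cr x y ≠ 0 := by
    intro h0
    have e : dt x x • y - dt x y • x = 0 := by
      have e' : dt x x • y - dt x y • x = cr (cr x y) x := by
        ext <;> simp [dt, cr, rx, ry] <;> ring
      rw [e', h0]; ext <;> simp [cr]
    have := (hli (-(dt x y)) (dt x x) 0 (by rw [← e]; module)).2.1
    exact (dt_pos hp hq rx x0).ne' this
  have h2 := dt_pos hp hq (cr_re x y) h1
  refine ⟨?_, by rw [lagr]; exact h2⟩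
  intro hv
  have h3 := cramer x y z (cr x y) (cr_re x y) rx ry rz
  rw [hv, zero_smul] at h3
  exact h2.ne' (hli _ _ _ h3.symm).2.2

/-- minimality in coordinates -/
structure Mini (T : Set (Bq p q)) (x y z : Bq p q) : Prop where
  P3 : ∀ α β γ : ℚ, α • x + β • y + γ • z ∈ T → γ ≠ 0 → dt z z ≤ qf x y z α β γ
  P2 : ∀ α β : ℚ, α • x + β • y + (0:ℚ) • z ∈ T → β ≠ 0 → dt y y ≤ qf x y z α β 0
  P1 : ∀ α : ℚ, α • x + (0:ℚ) • y + (0:ℚ) • z ∈ T → α ≠ 0 → dt x x ≤ qf x y z α 0 0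
  AB : dt x x ≤ dt y y
  BC : dt y y ≤ dt z z

lemma mini_of {O : Subring (Bq p q)} (hO : IsOrder O) {D₁ D₂ D₃ : ℝ} {x y z : Bq p q}
    (hm1 : SuccMin (GrossLat O) 1 D₁) (hm2 : SuccMin (GrossLat O) 2 D₂)
    (hm3 : SuccMin (GrossLat O) 3 D₃)
    (hx : x ∈ GrossLat O) (hy : y ∈ GrossLat O) (hz : z ∈ GrossLat O)
    (hxD : (Nrq x : ℝ) = D₁) (hyD : (Nrq y : ℝ) = D₂) (hzD : (Nrq z : ℝ) = D₃)
    (hli : ∀ α β γ : ℚ, α • x + β • y + γ • z = 0 → α = 0 ∧ β = 0 ∧ γ = 0) :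
    Mini (GrossLat O) x y z := by
  have m1 : ∀ t ∈ GrossLat O, t ≠ 0 → D₁ ≤ Nrq t := by
    intro t ht h0
    apply hm1.2
    refine ⟨![t], ?_, ?_, ?_⟩
    · simpa using ht
    · exact LinearIndependent.of_subsingleton (v := ![t]) 0 h0
    · simp
  have m2 : ∀ t ∈ GrossLat O, LinearIndependent ℚ ![t, x] → D₂ ≤ Nrq t := by
    intro t ht hl
    have h0 : t ≠ 0 := hl.ne_zero 0
    have h1 := m1 t ht h0
    apply hm2.2
    refine ⟨![t, x], ?_, hl, ?_⟩
    · intro n; fin_cases n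
      · exact ht
      · exact hx
    · intro n; fin_cases n
      · simp
      · simp [hxD, h1]
  have m3 : ∀ t ∈ GrossLat O, LinearIndependent ℚ ![t, x] → LinearIndependent ℚ ![t, x, y] →
      D₃ ≤ Nrq t := by
    intro t ht hl hl3
    have h1 := m1 t ht (hl.ne_zero 0)
    have h2 := m2 t ht hl
    apply hm3.2
    refine ⟨![t, x, y], ?_, hl3, ?_⟩
    · intro n; fin_cases n
      · exact ht
      · exact hx
      · exact hy
    · intro n; fin_cases n
      · simp
      · simp [hxD, h1]
      · simp [hyD, h2]
  have conv : ∀ t ∈ GrossLat O, Nrq t = dt t t := fun t ht => nr_pure (gross_data hO ht).1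
  refine ⟨?_, ?_, ?_, ?_, ?_⟩
  · intro α β γ hT hγ
    have hpair : LinearIndependent ℚ ![α • x + β • y + γ • z, x] := by
      rw [LinearIndependent.pair_iff]
      intro s t hst
      have := hli (s * α + t) (s * β) (s * γ) (by rw [← hst]; module)
      have hs : s = 0 := by simpa [hγ] using this.2.2
      refine ⟨hs, ?_⟩
      simpa [hs] using this.1
    have h3 : LinearIndependent ℚ ![α • x + β • y + γ • z, x, y] := by
      rw [Fintype.linearIndependent_iff]
      intro g hg
      simp only [Fin.sum_univ_three, Matrix.cons_val_zero, Matrix.cons_val_one, Matrix.cons_val] at hg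
      have := hli (g 0 * α + g 1) (g 0 * β + g 2) (g 0 * γ) (by rw [← hg]; module)
      have hs : g 0 = 0 := by simpa [hγ] using this.2.2
      intro i; fin_cases i
      · exact hs
      · simpa [hs] using this.1
      · simpa [hs] using this.2.1
    have := m3 _ hT hpair h3
    rw [← hzD] at this
    have h4 : Nrq z ≤ Nrq (α • x + β • y + γ • z) := by exact_mod_cast this
    rw [conv _ hT, qf_eq] at h4
    refine le_trans ?_ h4
    rw [nr_eq]; nlinarith [sq_nonneg z.re]
  · intro α β hT hβ
    have hpair : LinearIndependent ℚ ![α • x + β • y + (0:ℚ) • z, x] := by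
      rw [LinearIndependent.pair_iff]
      intro s t hst
      have := hli (s * α + t) (s * β) 0 (by rw [← hst]; module)
      have hs : s = 0 := by simpa [hβ] using this.2.1
      refine ⟨hs, ?_⟩
      simpa [hs] using this.1
    have := m2 _ hT hpair
    rw [← hyD] at this
    have h4 : Nrq y ≤ Nrq (α • x + β • y + (0:ℚ) • z) := by exact_mod_cast this
    rwa [conv _ hT, qf_eq, conv _ hy] at h4
  · intro α hT hα
    have h0 : α • x + (0:ℚ) • y + (0:ℚ) • z ≠ 0 := fun h => hα (hli _ _ _ h).1
    have := m1 _ hT h0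
    rw [← hxD] at this
    have h4 : Nrq x ≤ Nrq (α • x + (0:ℚ) • y + (0:ℚ) • z) := by exact_mod_cast this
    rwa [conv _ hT, qf_eq, conv _ hx] at h4
  · have y0 : y ≠ 0 := by
      rintro rfl
      have := (hli 0 1 0 (by simp)).2.1
      norm_num at this
    have := m1 y hy y0
    rw [← hxD] at this
    have h4 : Nrq x ≤ Nrq y := by exact_mod_cast this
    rwa [conv _ hx, conv _ hy] at h4
  · have hpair : LinearIndependent ℚ ![z, x] := by
      rw [LinearIndependent.pair_iff]
      intro s t hst
      have := hli t 0 s (by rw [← hst]; module)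
      exact ⟨this.2.2, this.1⟩
    have := m2 z hz hpair
    rw [← hyD] at this
    have h4 : Nrq y ≤ Nrq z := by exact_mod_cast this
    rwa [conv _ hy, conv _ hz] at h4

lemma mini_basis {O : Subring (Bq p q)} (hO : IsOrder O) (hp : 0 < p) (hq : 0 < q) {x y z : Bq p q}
    (hx : x ∈ GrossLat O) (hy : y ∈ GrossLat O) (hz : z ∈ GrossLat O)
    (hli : ∀ α β γ : ℚ, α • x + β • y + γ • z = 0 → α = 0 ∧ β = 0 ∧ γ = 0)
    (hM : Mini (GrossLat O) x y z) (t : Bq p q) (ht : t ∈ GrossLat O) :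
    ∃ a b c : ℤ, t = (a:ℚ) • x + (b:ℚ) • y + (c:ℚ) • z := by
  have rx := (gross_data hO hx).1
  have ry := (gross_data hO hy).1
  have rz := (gross_data hO hz).1
  obtain ⟨hv, hAB⟩ := vol_ne hp hq rx ry rz hli
  have x0 : x ≠ 0 := by
    rintro rfl
    have := (hli 1 0 0 (by simp)).1
    norm_num at this
  have hA := dt_pos hp hq rx x0
  have hAleB := hM.AB
  have hBleC := hM.BC
  -- coordinates
  obtain ⟨α, β, γ, hc⟩ : ∃ α β γ : ℚ, t = α • x + β • y + γ • z := by
    have h1 := cramer x y z t (gross_data hO ht).1 rx ry rz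
    refine ⟨(vol x y z)⁻¹ * dt t (cr y z), (vol x y z)⁻¹ * dt t (cr z x),
      (vol x y z)⁻¹ * dt t (cr x y), ?_⟩
    have : t = (vol x y z)⁻¹ • (vol x y z • t) := by
      rw [smul_smul, inv_mul_cancel₀ hv, one_smul]
    refine this.trans ?_
    rw [h1]
    module
  have hshift : ∀ m n k : ℤ, (α - m) • x + (β - n) • y + (γ - k) • z ∈ GrossLat O := by
    intro m n k
    have h1 := gross_add (gross_add (gross_add ht (gross_smul (-m) hx)) (gross_smul (-n) hy))
      (gross_smul (-k) hz)
    convert h1 using 1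
    rw [hc]; push_cast; module
  set A := dt x x
  set B := dt y y
  set C := dt z z
  have hγr : ∃ k : ℤ, (γ - k) ^ 2 ≤ 1 / 4 := by
    refine ⟨round γ, ?_⟩
    have := abs_le.1 (abs_sub_round γ)
    nlinarith [this.1, this.2]
  obtain ⟨k, hk⟩ := hγr
  obtain ⟨m, n, hmn⟩ := babai A B C (dt y z) (dt x z) (dt x y) α β (γ - k) hA hAB
  have hs := hshift m n k
  have hγ : γ - k = 0 := by
    by_contra hne
    have := hM.P3 _ _ _ hs hne
    unfold qf at this
    change C ≤ A * _ + B * _ + C * _ + _ + _ + _ at this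
    nlinarith
  have hβ : β - n = 0 := by
    by_contra hne
    rw [hγ] at hs hmn
    have := hM.P2 _ _ hs hne
    unfold qf at this
    change B ≤ A * _ + B * _ + C * _ + _ + _ + _ at this
    nlinarith
  obtain ⟨m, hm⟩ : ∃ m : ℤ, (α - m) ^ 2 ≤ 1 / 4 := by
    refine ⟨round α, ?_⟩
    have := abs_le.1 (abs_sub_round α)
    nlinarith [this.1, this.2]
  have hs := hshift m n k
  have hα : α - m = 0 := by
    by_contra hne
    rw [hγ, hβ] at hs
    have := hM.P1 _ hs hne
    unfold qf at this
    change A ≤ A * _ + B * _ + C * _ + _ + _ + _ at this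
    nlinarith
  refine ⟨m, n, k, ?_⟩
  rw [hc, sub_eq_zero.1 hα, sub_eq_zero.1 hβ, sub_eq_zero.1 hγ]

end GrossPf

namespace GrossPf

variable {p q : ℕ}

lemma prod_mem {O : Subring (Bq p q)} {s t : Bq p q} {r r' : ℤ} (hs : s.re = 0) (ht : t.re = 0)
    (h1 : ee r s ∈ O) (h2 : ee r' t ∈ O) :
    (1/2 : ℚ) • ((r:ℚ) • t + (r':ℚ) • s + cr s t) ∈ GrossLat O := by
  refine ⟨_, mul_mem h1 h2, ?_⟩
  rw [ee_mul hs ht]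
  rw [two_mul]
  have e : Trq ((1/4 : ℚ) • ((r * r' - dt s t : ℚ) • (1 : Bq p q) + (r:ℚ) • t + (r':ℚ) • s + cr s t))
     = (r * r' - dt s t) / 2 := by
    simp [Trq, hs, ht, cr]; ring
  rw [e]
  generalize ((r * r' - dt s t : ℚ)) = d
  have e2 : algebraMap ℚ (Bq p q) (d / 2) = (d / 2) • 1 := by rw [Algebra.algebraMap_eq_smul_one]
  rw [e2]
  module

lemma cross_coef {O : Subring (Bq p q)} {s t t1 t2 t3 : Bq p q} {r r' : ℤ} (hs : s.re = 0) (ht : t.re = 0)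
    (h1 : ee r s ∈ O) (h2 : ee r' t ∈ O)
    (hB : ∀ t ∈ GrossLat O, ∃ a b c : ℤ, t = (a:ℚ) • t1 + (b:ℚ) • t2 + (c:ℚ) • t3) :
    ∃ a b c : ℤ, cr s t = (2 * a : ℚ) • t1 + (2 * b : ℚ) • t2 + (2 * c : ℚ) • t3
      - (r:ℚ) • t - (r':ℚ) • s := by
  obtain ⟨a, b, c, h⟩ := hB _ (prod_mem hs ht h1 h2)
  refine ⟨a, b, c, ?_⟩
  have e : cr s t = (2:ℚ) • ((1/2 : ℚ) • ((r:ℚ) • t + (r':ℚ) • s + cr s t)) - (r:ℚ) • t - (r':ℚ) • s := by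
    module
  rw [e, h]; module

lemma cross_symm {t1 t2 t3 : Bq p q} {a b v w w' u : ℚ} (hv : vol t1 t2 t3 ≠ 0)
    (h1 : cr t2 t3 = a • t1 + w • t2 + v • t3) (h2 : cr t3 t1 = w' • t1 + b • t2 + u • t3) :
    w = w' := by
  have e1 : dt (cr t2 t3) (cr t3 t1) = w * vol t1 t2 t3 := by
    conv_lhs => rw [h1]
    simp [vol, dt, cr]; ring
  have e2 : dt (cr t2 t3) (cr t3 t1) = w' * vol t1 t2 t3 := by
    conv_lhs => rw [h2]
    simp [vol, dt, cr]; ring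
  exact mul_right_cancel₀ hv (e1.symm.trans e2)

lemma ee_shift {O : Subring (Bq p q)} {t : Bq p q} {r : ℤ} (h : ee r t ∈ O) (k : ℤ) :
    ee (2 * k - r) t ∈ O := by
  have : ee (2 * k - r) t = ee r t + algebraMap ℚ (Bq p q) ((k - r : ℤ) : ℚ) := by
    ext <;> simp [ee_re, ee_imI, ee_imJ, ee_imK] ; ring
  rw [this]
  exact add_mem h (int_mem O _)

lemma good_of_basis {O : Subring (Bq p q)} (hO : IsOrder O) {t1 t2 t3 : Bq p q}
    (h1 : t1 ∈ GrossLat O) (h2 : t2 ∈ GrossLat O) (h3 : t3 ∈ GrossLat O)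
    (hv : vol t1 t2 t3 ≠ 0)
    (hB : ∀ t ∈ GrossLat O, ∃ a b c : ℤ, t = (a:ℚ) • t1 + (b:ℚ) • t2 + (c:ℚ) • t3) :
    ∃ a b c u v w : ℤ, Good O t1 t2 t3 a b c u v w := by
  obtain ⟨e1, ⟨r1, hr1⟩, -⟩ := gross_data hO h1
  obtain ⟨e2, ⟨r2, hr2⟩, -⟩ := gross_data hO h2
  obtain ⟨e3, ⟨r3, hr3⟩, -⟩ := gross_data hO h3
  obtain ⟨a1, b1, c1, k1⟩ := cross_coef e2 e3 hr2 hr3 hB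
  obtain ⟨a2, b2, c2, k2⟩ := cross_coef e3 e1 hr3 hr1 hB
  obtain ⟨a3, b3, c3, k3⟩ := cross_coef e1 e2 hr1 hr2 hB
  have hv2 : vol t2 t3 t1 ≠ 0 := by
    intro h'; apply hv; rw [← h']; simp [vol, dt, cr]; ring
  have hv3 : vol t3 t1 t2 ≠ 0 := by
    intro h'; apply hv; rw [← h']; simp [vol, dt, cr]; ring
  have l1 : cr t2 t3 = (2 * a1 : ℚ) • t1 + (2 * b1 - r3 : ℚ) • t2 + (2 * c1 - r2 : ℚ) • t3 := by
    rw [k1]; module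
  have l2 : cr t3 t1 = (2 * a2 - r3 : ℚ) • t1 + (2 * b2 : ℚ) • t2 + (2 * c2 - r1 : ℚ) • t3 := by
    rw [k2]; module
  have l3 : cr t1 t2 = (2 * a3 - r2 : ℚ) • t1 + (2 * b3 - r1 : ℚ) • t2 + (2 * c3 : ℚ) • t3 := by
    rw [k3]; module
  have s1 := cross_symm hv l1 l2
  have s2 := cross_symm hv2 (a := 2 * b2) (w := 2 * c2 - r1) (v := 2 * a2 - r3) (w' := 2 * b3 - r1)
    (b := 2 * c3) (u := 2 * a3 - r2) (by rw [l2]; module) (by rw [l3]; module)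
  have s3 := cross_symm hv3 (a := 2 * c3) (w := 2 * a3 - r2) (v := 2 * b3 - r1) (w' := 2 * c1 - r2)
    (b := 2 * a1) (u := 2 * b1 - r3) (by rw [l3]; module) (by rw [l1]; module)
  have hC : Cross t1 t2 t3 a1 b2 c3 (2 * b3 - r1) (2 * c1 - r2) (2 * a2 - r3) := by
    refine ⟨e1, e2, e3, ?_, ?_, ?_, hv⟩
    · rw [l1, s1]; push_cast; rfl
    · rw [l2, s2]; push_cast; rfl
    · rw [l3, s3]; push_cast; rfl
  have f1 := ee_shift hr1 b3
  have f2 := ee_shift hr2 c1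
  have f3 := ee_shift hr3 a2
  generalize (2 * b3 - r1) = u at *
  generalize (2 * c1 - r2) = v at *
  generalize (2 * a2 - r3) = w at *
  refine ⟨a1, b2, c3, u, v, w, hC, fun x => ⟨fun hx => ?_, fun hx => ?_⟩⟩
  · obtain ⟨n1, n2, n3, hn⟩ := hB _ ⟨x, hx, rfl⟩
    have hx' : x = n1 • ee u t1 + n2 • ee v t2 + n3 • ee w t3 + algebraMap ℚ (Bq p q)
        (x.re - (n1 * u + n2 * v + n3 * w) / 2) := by
      have htr : Trq x = 2 * x.re := rfl
      generalize Trq x = τ at *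
      rw [QuaternionAlgebra.ext_iff, two_mul] at hn
      obtain ⟨-, hi, hj, hk⟩ := hn
      simp at hi hj hk
      generalize hd : x.re - (n1 * u + n2 * v + n3 * w : ℚ) / 2 = d
      ext
      · simp [ee_re, e1, e2, e3]; linarith
      · simp [ee_imI]; linarith
      · simp [ee_imJ]; linarith
      · simp [ee_imK]; linarith
    generalize x.re - (n1 * u + n2 * v + n3 * w : ℚ) / 2 = d at hx'
    have hd : algebraMap ℚ (Bq p q) d ∈ O := by
      have e : algebraMap ℚ (Bq p q) d = x - (n1 • ee u t1 + n2 • ee v t2 + n3 • ee w t3) := by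
        conv_rhs => rw [hx']
        abel
      rw [e]
      exact sub_mem hx (add_mem (add_mem (zsmul_mem f1 _) (zsmul_mem f2 _)) (zsmul_mem f3 _))
    obtain ⟨m, rfl⟩ := rat_mem_int hO hd
    have e : algebraMap ℚ (Bq p q) (m:ℚ) = m • 1 := by simp
    rw [hx', e]
    exact add_mem (add_mem (add_mem (Submodule.smul_mem _ _ (e1_mem_LL _ _ _ _ _ _))
      (Submodule.smul_mem _ _ (e2_mem_LL _ _ _ _ _ _)))
      (Submodule.smul_mem _ _ (e3_mem_LL _ _ _ _ _ _)))
      (Submodule.smul_mem _ _ (one_mem_LL _ _ _ _ _ _))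
  · have hle : LL t1 t2 t3 u v w ≤ O.toAddSubgroup.toIntSubmodule := by
      rw [LL, Submodule.span_le]
      rintro s hs
      simp only [Set.mem_insert_iff, Set.mem_singleton_iff] at hs
      rcases hs with rfl | rfl | rfl | rfl
      · exact one_mem O
      · exact f1
      · exact f2
      · exact f3
    exact hle hx

end GrossPf

namespace GrossPf

variable {p q : ℕ}

lemma red_pos (A B f g h : ℚ) (hA : 0 < A) (hAB : A ≤ B) (h0 : 0 ≤ h) (h1 : 2 * h ≤ A)
    (f0 : 0 ≤ f) (g0 : 0 ≤ g) (f1 : 2 * f ≤ B) (g1 : 2 * g ≤ A) :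
    A * f ^ 2 + B * g ^ 2 - 2 * f * g * h ≤ A * B * (A + B - 2 * h) / 4 := by
  have hB : 0 < B := by linarith
  have e1 : 0 ≤ A * (f * (B / 2 - f)) := mul_nonneg hA.le (mul_nonneg f0 (by linarith))
  have e2 : 0 ≤ A * B / 2 - 2 * g * h := by nlinarith [mul_nonneg g0 h0, mul_nonneg g0 (sub_nonneg.2 h1), mul_nonneg hA.le (sub_nonneg.2 g1), mul_nonneg hA.le (sub_nonneg.2 hAB)]
  have e3 : 0 ≤ (B / 2 - f) * (A * B / 2 - 2 * g * h) := mul_nonneg (by linarith) e2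
  have e4 : 0 ≤ B * (g * (A / 2 - g)) := mul_nonneg hB.le (mul_nonneg g0 (by linarith))
  have e5 : 0 ≤ B * ((A / 2 - h) * (A / 2 - g)) :=
    mul_nonneg hB.le (mul_nonneg (by linarith) (by linarith))
  nlinarith

lemma red_neg (A B f g h : ℚ) (hA : 0 < A) (hAB : A ≤ B) (h0 : 0 ≤ h) (h1 : 2 * h ≤ A)
    (f0 : 0 ≤ f) (g0 : 0 ≤ g) (f1 : 2 * f ≤ B) (g1 : 2 * g ≤ A) (hm : 0 ≤ A + B - 2 * f - 2 * g - 2 * h) :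
    A * f ^ 2 + B * g ^ 2 + 2 * f * g * h ≤ A * B * (A + B - 2 * h) / 4 := by
  have hB : 0 < B := by linarith
  rcases le_total g (A / 2 - h) with hg | hg
  · have e1 : f ^ 2 ≤ (B / 2) ^ 2 := pow_le_pow_left₀ f0 (by linarith) 2
    have e2 : f * (g * h) ≤ B / 2 * (g * h) :=
      mul_le_mul_of_nonneg_right (by linarith) (mul_nonneg g0 h0)
    have e3 : g * (g + h) ≤ (A / 2 - h) * (A / 2) :=
      mul_le_mul hg (by linarith) (by linarith) (by linarith)
    nlinarith [mul_le_mul_of_nonneg_left e1 hA.le, mul_le_mul_of_nonneg_left e3 hB.le]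
  · have e0 : f ≤ (A + B - 2 * h) / 2 - g := by linarith
    have e1 : f ^ 2 ≤ ((A + B - 2 * h) / 2 - g) ^ 2 := pow_le_pow_left₀ f0 e0 2
    have e2 : f * (g * h) ≤ ((A + B - 2 * h) / 2 - g) * (g * h) :=
      mul_le_mul_of_nonneg_right e0 (mul_nonneg g0 h0)
    have e3 : 0 ≤ (A + B - 2 * h) * ((g - A / 2 + h) * (A / 2 - g)) :=
      mul_nonneg (by linarith) (mul_nonneg (by linarith) (by linarith))
    nlinarith [mul_le_mul_of_nonneg_left e1 hA.le]

lemma red_main (A B C f g h : ℚ) (hA : 0 < A) (hAB : A ≤ B) (hBC : B ≤ C) (h0 : 0 ≤ h)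
    (h1 : 2 * h ≤ A) (f1 : |2 * f| ≤ B) (g1 : |2 * g| ≤ A)
    (m1 : 0 ≤ A + B - 2 * f + 2 * g - 2 * h) (m2 : 0 ≤ A + B + 2 * f - 2 * g - 2 * h) :
    A * B * C ≤ 2 * (A * B * C + 2 * f * g * h - A * f ^ 2 - B * g ^ 2 - C * h ^ 2) ∧
    (A * B * C = 2 * (A * B * C + 2 * f * g * h - A * f ^ 2 - B * g ^ 2 - C * h ^ 2) →
      A = B ∧ B = C) := by
  have hB : 0 < B := by linarith
  obtain ⟨f1, f2⟩ := abs_le.1 f1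
  obtain ⟨g1, g2⟩ := abs_le.1 g1
  have hK : A * f ^ 2 + B * g ^ 2 - 2 * f * g * h ≤ A * B * (A + B - 2 * h) / 4 := by
    rcases le_total 0 f with hf | hf <;> rcases le_total 0 g with hg | hg
    · exact red_pos A B f g h hA hAB h0 h1 hf hg f2 g2
    · have := red_neg A B f (-g) h hA hAB h0 h1 hf (by linarith) f2 (by linarith) (by linarith)
      linarith
    · have := red_neg A B (-f) g h hA hAB h0 h1 (by linarith) hg (by linarith) g2 (by linarith)
      linarith
    · have := red_pos A B (-f) (-g) h hA hAB h0 h1 (by linarith) (by linarith) (by linarith) (by linarith)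
      linarith
  have p1 : 0 < A * B / 2 - h ^ 2 := by nlinarith
  have k1 : 0 ≤ (A * B / 2 - h ^ 2) * (C - B) := mul_nonneg p1.le (by linarith)
  have k2 : 0 ≤ B * (A * (B - A)) := mul_nonneg hB.le (mul_nonneg hA.le (by linarith))
  have k3 : 0 ≤ B * (h * (A - 2 * h)) := mul_nonneg hB.le (mul_nonneg h0 (by linarith))
  refine ⟨by nlinarith, fun heq => ?_⟩
  have z1 : (A * B / 2 - h ^ 2) * (C - B) = 0 := by nlinarith
  have z2 : B * (A * (B - A)) = 0 := by nlinarith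
  have z1' := (mul_eq_zero.1 z1).resolve_left p1.ne'
  have z2' := (mul_eq_zero.1 ((mul_eq_zero.1 z2).resolve_left hB.ne')).resolve_left hA.ne'
  constructor <;> linarith

lemma red_full (A B C f g h : ℚ) (hA : 0 < A) (hAB : A ≤ B) (hBC : B ≤ C)
    (h1 : |2 * h| ≤ A) (f1 : |2 * f| ≤ B) (g1 : |2 * g| ≤ A)
    (m1 : 0 ≤ A + B - 2 * f + 2 * g - 2 * h) (m2 : 0 ≤ A + B + 2 * f - 2 * g - 2 * h)
    (m3 : 0 ≤ A + B + 2 * f + 2 * g + 2 * h) (m4 : 0 ≤ A + B - 2 * f - 2 * g + 2 * h) :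
    A * B * C ≤ 2 * (A * B * C + 2 * f * g * h - A * f ^ 2 - B * g ^ 2 - C * h ^ 2) ∧
    (A * B * C = 2 * (A * B * C + 2 * f * g * h - A * f ^ 2 - B * g ^ 2 - C * h ^ 2) →
      A = B ∧ B = C) := by
  obtain ⟨h1, h2⟩ := abs_le.1 h1
  rcases le_total 0 h with hh | hh
  · exact red_main A B C f g h hA hAB hBC hh h2 f1 g1 m1 m2
  · have := red_main A B C (-f) g (-h) hA hAB hBC (by linarith) (by linarith)
      (by rwa [mul_neg, abs_neg]) g1 (by linarith) (by linarith)
    have e : A * B * C + 2 * -f * g * -h - A * (-f) ^ 2 - B * g ^ 2 - C * (-h) ^ 2 =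
      A * B * C + 2 * f * g * h - A * f ^ 2 - B * g ^ 2 - C * h ^ 2 := by ring
    rwa [e] at this

lemma had (A B C f g h : ℚ) (hA : 0 < A) (hC : 0 < C) (hAB : 0 < A * B - h ^ 2) :
    A * B * C + 2 * f * g * h - A * f ^ 2 - B * g ^ 2 - C * h ^ 2 ≤ A * B * C := by
  have e : 0 ≤ A * (A * f ^ 2 + B * g ^ 2 - 2 * f * g * h) := by
    nlinarith [sq_nonneg (A * f - g * h), mul_nonneg hAB.le (sq_nonneg g)]
  have e' := nonneg_of_mul_nonneg_right e hA
  nlinarith [mul_nonneg hC.le (sq_nonneg h)]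

lemma final_bounds {O : Subring (Bq p q)} (hO : IsMaximalOrder O) (hp : p.Prime) (hodd : Odd p)
    (hq : q.Prime) (hq8 : q % 8 = 3) (hqr : ∃ r : ℤ, (q : ℤ) ∣ r ^ 2 + p) {x y z : Bq p q}
    (hx : x ∈ GrossLat O) (hy : y ∈ GrossLat O) (hz : z ∈ GrossLat O)
    (hli : ∀ α β γ : ℚ, α • x + β • y + γ • z = 0 → α = 0 ∧ β = 0 ∧ γ = 0)
    (hM : Mini (GrossLat O) x y z) :
    4 * (p:ℚ) ^ 2 ≤ dt x x * dt y y * dt z z ∧ dt x x * dt y y * dt z z < 8 * (p:ℚ) ^ 2 := by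
  obtain ⟨rx, -, A', hA', mA⟩ := gross_data hO.1 hx
  obtain ⟨ry, -, B', hB', mB⟩ := gross_data hO.1 hy
  obtain ⟨rz, -, C', hC', mC⟩ := gross_data hO.1 hz
  obtain ⟨hv, hdet2⟩ := vol_ne hp.pos hq.pos rx ry rz hli
  have hbas := mini_basis hO.1 hp.pos hq.pos hx hy hz hli hM
  obtain ⟨a, b, c, u, v, w, hG⟩ := good_of_basis hO.1 hx hy hz hv hbas
  have gN := global_N hO hp hodd hq hq8 hqr hG
  have hdet : dt x x * dt y y * dt z z + 2 * dt y z * dt x z * dt x y - dt x x * dt y z ^ 2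
      - dt y y * dt x z ^ 2 - dt z z * dt x y ^ 2 = 4 * ((NN a b c u v w ^ 2 : ℤ) : ℚ) := by
    rw [hG.1.g11, hG.1.perm.g11, hG.1.perm.perm.g11, hG.1.g12, hG.1.perm.g12, dt_comm x z,
      hG.1.perm.perm.g12]
    unfold NN; push_cast; ring
  have memc : ∀ i j k : ℤ, (i:ℚ) • x + (j:ℚ) • y + (k:ℚ) • z ∈ GrossLat O := fun i j k =>
    gross_add (gross_add (gross_smul i hx) (gross_smul j hy)) (gross_smul k hz)
  have x0 : x ≠ 0 := by
    rintro rfl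
    have := (hli 1 0 0 (by simp)).1
    norm_num at this
  have hA := dt_pos hp.pos hq.pos rx x0
  have q3 : ∀ i j : ℤ, dt z z ≤ qf x y z i j 1 := fun i j =>
    hM.P3 i j 1 (by simpa using memc i j 1) one_ne_zero
  have q2 : ∀ i : ℤ, dt y y ≤ qf x y z i 1 0 := fun i =>
    hM.P2 i 1 (by simpa using memc i 1 0) one_ne_zero
  have i1 := q2 1
  have i2 := q2 (-1)
  have i3 := q3 1 0
  have i4 := q3 (-1) 0
  have i5 := q3 0 1
  have i6 := q3 0 (-1)
  have i7 := q3 1 (-1)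
  have i8 := q3 (-1) 1
  have i9 := q3 1 1
  have i10 := q3 (-1) (-1)
  unfold qf at i1 i2 i3 i4 i5 i6 i7 i8 i9 i10
  push_cast at i1 i2 i3 i4 i5 i6 i7 i8 i9 i10
  have hAB := hM.AB
  have hBC := hM.BC
  obtain ⟨R1, R2⟩ := red_full (dt x x) (dt y y) (dt z z) (dt y z) (dt x z) (dt x y) hA hAB hBC
    (abs_le.2 ⟨by linarith, by linarith⟩) (abs_le.2 ⟨by linarith, by linarith⟩)
    (abs_le.2 ⟨by linarith, by linarith⟩) (by linarith) (by linarith) (by linarith) (by linarith)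
  have hH := had (dt x x) (dt y y) (dt z z) (dt y z) (dt x z) (dt x y) hA (by linarith) hdet2
  rw [hdet] at R1 R2 hH
  rw [hA'] at hA hAB
  rw [hA', hB', hC'] at R1 R2 hH ⊢
  rw [hB'] at hAB hBC
  rw [hC'] at hBC
  have zA : 0 < A' := by exact_mod_cast hA
  have zAB : A' ≤ B' := by exact_mod_cast hAB
  have zBC : B' ≤ C' := by exact_mod_cast hBC
  have zR : A' * B' * C' ≤ 2 * (4 * NN a b c u v w ^ 2) := by exact_mod_cast R1
  have zH : 4 * NN a b c u v w ^ 2 ≤ A' * B' * C' := by exact_mod_cast hH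
  have R2' : A' * B' * C' = 2 * (4 * NN a b c u v w ^ 2) → A' = B' ∧ B' = C' := by
    exact_mod_cast R2
  have hN : NN a b c u v w ^ 2 = p ^ 2 := by
    refine gN.resolve_left fun h1 => ?_
    rw [h1] at zR
    have a3 : 3 ≤ A' := by omega
    have b3 : 3 ≤ B' := by omega
    have c3 : 3 ≤ C' := by omega
    have : 3 * 3 ≤ A' * B' := mul_le_mul a3 b3 (by norm_num) (by omega)
    have : 3 * 3 * 3 ≤ A' * B' * C' := mul_le_mul this c3 (by norm_num) (by linarith)
    omega
  rw [hN] at zR zH R2'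
  have hlt : A' * B' * C' < 8 * (p:ℤ) ^ 2 := by
    refine lt_of_le_of_ne (by linarith) fun heq => ?_
    obtain ⟨rfl, rfl⟩ := R2' (by linarith)
    have hpP : Prime (p:ℤ) := Nat.prime_iff_prime_int.1 hp
    have hd : (p:ℤ) ∣ A' := by
      apply hpP.dvd_of_dvd_pow (n := 3)
      exact ⟨8 * p, by linear_combination heq⟩
    obtain ⟨k, rfl⟩ := hd
    have h8 : (p:ℤ) * k ^ 3 = 2 ^ 3 := by
      have : (p:ℤ) ^ 2 ≠ 0 := pow_ne_zero 2 hpP.ne_zero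
      apply mul_left_cancel₀ this
      linear_combination heq
    have h2 : (p:ℤ) ∣ 2 := hpP.dvd_of_dvd_pow (n := 3) ⟨_, h8.symm⟩
    have h2' : p ∣ 2 := by exact_mod_cast h2
    have := (Nat.prime_dvd_prime_iff_eq hp Nat.prime_two).1 h2'
    rw [this] at hodd
    exact absurd hodd (by decide)
  constructor
  · exact_mod_cast zH
  · exact_mod_cast hlt

end GrossPf

/-- bounds `4p² ≤ D₁D₂D₃ < 8p²`, and the minima form a `ℤ`-basis of `O^T`. -/
theorem minima_basis_and_bounds (p q : ℕ) (hp : Nat.Prime p) (hodd : Odd p) (hq : Nat.Prime q)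
    (hq8 : q % 8 = 3) (hqr : ∃ r : ℤ, (q : ℤ) ∣ r ^ 2 + p)
    (O : Subring (Bq p q)) (hO : IsMaximalOrder O)
    (D₁ D₂ D₃ : ℝ) (x y z : Bq p q)
    (hm1 : SuccMin (GrossLat O) 1 D₁) (hm2 : SuccMin (GrossLat O) 2 D₂)
    (hm3 : SuccMin (GrossLat O) 3 D₃)
    (hx : x ∈ GrossLat O) (hy : y ∈ GrossLat O) (hz : z ∈ GrossLat O)
    (hxD : (Nrq x : ℝ) = D₁) (hyD : (Nrq y : ℝ) = D₂) (hzD : (Nrq z : ℝ) = D₃)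
    (hxy : LinearIndependent ℚ ![x, y])
    (hzxy : z ∉ Submodule.span ℚ ({x, y} : Set (Bq p q))) :
    (4 * (p : ℝ) ^ 2 ≤ D₁ * D₂ * D₃ ∧ D₁ * D₂ * D₃ < 8 * (p : ℝ) ^ 2) ∧
    GrossLat O = {t : Bq p q | ∃ a b c : ℤ, t = a • x + b • y + c • z} := by
  have hli := GrossPf.li3 hxy hzxy
  have hM := GrossPf.mini_of hO.1 hm1 hm2 hm3 hx hy hz hxD hyD hzD hli
  obtain ⟨h1, h2⟩ := GrossPf.final_bounds hO hp hodd hq hq8 hqr hx hy hz hli hM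
  rw [← GrossPf.nr_pure (GrossPf.gross_data hO.1 hx).1,
    ← GrossPf.nr_pure (GrossPf.gross_data hO.1 hy).1,
    ← GrossPf.nr_pure (GrossPf.gross_data hO.1 hz).1] at h1 h2
  rw [← hxD, ← hyD, ← hzD]
  refine ⟨⟨by exact_mod_cast h1, by exact_mod_cast h2⟩, ?_⟩
  ext t
  simp only [Set.mem_setOf_eq]
  constructor
  · intro ht
    obtain ⟨a, b, c, h⟩ := GrossPf.mini_basis hO.1 hp.pos hq.pos hx hy hz hli hM t ht
    refine ⟨a, b, c, ?_⟩
    rw [h]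
    simp only [Int.cast_smul_eq_zsmul]
  · rintro ⟨a, b, c, rfl⟩
    simp only [← Int.cast_smul_eq_zsmul ℚ]
    exact GrossPf.gross_add (GrossPf.gross_add (GrossPf.gross_smul a hx) (GrossPf.gross_smul b hy))
      (GrossPf.gross_smul c hz)
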